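/- arXiv:2405.20303 — 13 statements merged into one kernel-verified Lean document; each statement's English description precedes it below -/
import Mathlib

section
/- Let m ≥ 2 and let n ≥ 2 be even. Let P be the profile in which n/2 voters report the uniform vector u = (1/m, …, 1/m) and the other n/2 voters report e₁ = (1, 0, …, 0). Then every mechanism A : (Δ^{m−1})^n → Δ^{m−1} that is truthful, anonymous, neutral, and continuous satisfies A(P) = u; consequently ‖A(P) − μ(P)‖₁ = (m−1)/m and ‖A(P) − μ(P)‖_∞ = (m−1)/(2m). -/
open scoped Classical BigOperators

/-- The standard simplex Δ^{m-1} as a subset of ℝ^m. -/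
def simplex (m : ℕ) : Set (Fin m → ℝ) :=
  {x | (∀ j, 0 ≤ x j) ∧ ∑ j, x j = 1}

/-- ℓ1-distance on ℝ^m. -/
noncomputable def dist1 {m : ℕ} (x y : Fin m → ℝ) : ℝ :=
  ∑ j, |x j - y j|

/-- ℓ∞-distance on ℝ^m. -/
noncomputable def distInf {m : ℕ} (x y : Fin m → ℝ) : ℝ :=
  ⨆ j, |x j - y j|

/-- A mechanism is truthful if no voter can decrease the ℓ1-distance of the result
to her true report by misreporting. -/
def Truthful {n m : ℕ} (A : (Fin n → Fin m → ℝ) → (Fin m → ℝ)) : Prop :=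
  ∀ P : Fin n → Fin m → ℝ, (∀ i, P i ∈ simplex m) →
    ∀ i : Fin n, ∀ q ∈ simplex m,
      dist1 (P i) (A P) ≤ dist1 (P i) (A (Function.update P i q))

/-- Anonymity: the outcome is invariant under permutations of the voters. -/
def Anonymous {n m : ℕ} (A : (Fin n → Fin m → ℝ) → (Fin m → ℝ)) : Prop :=
  ∀ P : Fin n → Fin m → ℝ, (∀ i, P i ∈ simplex m) →
    ∀ σ : Equiv.Perm (Fin n), A (fun i => P (σ i)) = A P

/-- Neutrality: the outcome is equivariant under permutations of the alternatives. -/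
def Neutral {n m : ℕ} (A : (Fin n → Fin m → ℝ) → (Fin m → ℝ)) : Prop :=
  ∀ P : Fin n → Fin m → ℝ, (∀ i, P i ∈ simplex m) →
    ∀ σ : Equiv.Perm (Fin m), A (fun i j => P i (σ j)) = fun j => A P (σ j)

/-- The mean of a profile. -/
noncomputable def mean {n m : ℕ} (P : Fin n → Fin m → ℝ) : Fin m → ℝ :=
  fun j => (∑ i, P i j) / n

/-- The point of the simplex with coordinate `t` at `z` and equal other coordinates. -/
noncomputable def axisPoint {m : ℕ} (z : Fin m) (t : ℝ) : Fin m → ℝ :=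
  fun j => if j = z then t else (1 - t) / (m - 1)

/-- The two-voter mechanism obtained from `A` by letting the first half of the voters report `p`
and the other half report `q`. -/
def twoBlocs {n m : ℕ} (A : (Fin n → Fin m → ℝ) → (Fin m → ℝ)) (p q : Fin m → ℝ) :
    Fin m → ℝ :=
  A fun i : Fin n => if (i : ℕ) < n / 2 then p else q

lemma one_lt_cast_of_two_le {m : ℕ} (hm : 2 ≤ m) : (1 : ℝ) < m := by
  exact_mod_cast hm

lemma sum_eq_add_mul {m : ℕ} (z : Fin m) (f : Fin m → ℝ) (c : ℝ) (h : ∀ j, j ≠ z → f j = c) :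
    ∑ j, f j = f z + (m - 1) * c := by
  have hm : 1 ≤ m := z.pos
  rw [← Finset.add_sum_erase _ _ (Finset.mem_univ z),
    Finset.sum_congr rfl (fun j hj => h j (Finset.ne_of_mem_erase hj))]
  simp [Finset.card_erase_of_mem, Nat.cast_sub hm]

lemma axisPoint_self {m : ℕ} (z : Fin m) (t : ℝ) : axisPoint z t z = t := by
  simp [axisPoint]

lemma axisPoint_of_ne {m : ℕ} {z j : Fin m} (t : ℝ) (h : j ≠ z) :
    axisPoint z t j = (1 - t) / (m - 1) := by
  simp [axisPoint, h]

lemma axisPoint_mem_simplex {m : ℕ} (hm : 2 ≤ m) (z : Fin m) {t : ℝ} (ht : t ∈ Set.Icc 0 1) :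
    axisPoint z t ∈ simplex m := by
  have h1 := one_lt_cast_of_two_le hm
  have h2 : (m : ℝ) - 1 ≠ 0 := by linarith
  refine ⟨fun j => ?_, ?_⟩
  · unfold axisPoint
    split_ifs
    · exact ht.1
    · exact div_nonneg (by linarith [ht.2]) (by linarith)
  · rw [sum_eq_add_mul z _ _ (fun j hj => axisPoint_of_ne t hj), axisPoint_self]
    field_simp
    ring

lemma continuous_axisPoint {m : ℕ} (z : Fin m) : Continuous (axisPoint z) := by
  refine continuous_pi fun j => ?_
  unfold axisPoint
  split_ifs <;> fun_prop

lemma axisPoint_comp {m : ℕ} (z : Fin m) (t : ℝ) {σ : Equiv.Perm (Fin m)} (hσ : σ z = z) :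
    (fun j => axisPoint z t (σ j)) = axisPoint z t := by
  funext j
  have : σ j = z ↔ j = z := by
    rw [← hσ, σ.injective.eq_iff, hσ]
  simp [axisPoint, this]

lemma axisPoint_inv_card {m : ℕ} (hm : 2 ≤ m) (z : Fin m) :
    axisPoint z ((1 : ℝ) / m) = fun _ => (1 : ℝ) / m := by
  have h1 := one_lt_cast_of_two_le hm
  have h2 : (m : ℝ) - 1 ≠ 0 := by linarith
  funext j
  unfold axisPoint
  split_ifs
  · rfl
  · field_simp

lemma dist1_axisPoint {m : ℕ} (hm : 2 ≤ m) (z : Fin m) (s t : ℝ) :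
    dist1 (axisPoint z s) (axisPoint z t) = 2 * |s - t| := by
  have h1 := one_lt_cast_of_two_le hm
  have h2 : (0 : ℝ) < m - 1 := by linarith
  unfold dist1
  rw [sum_eq_add_mul z _ (|s - t| / (m - 1)), axisPoint_self, axisPoint_self]
  · field_simp
    ring
  · intro j hj
    rw [axisPoint_of_ne _ hj, axisPoint_of_ne _ hj, ← sub_div, abs_div, abs_of_pos h2,
      abs_sub_comm s t]
    ring_nf

/-- From `axisPoint z 0`, a point of the simplex with all coordinates at most `1 / (m - 1)` is
at distance twice its coordinate `z`. -/
lemma dist1_axisPoint_zero {m : ℕ} (hm : 2 ≤ m) (z : Fin m) {o : Fin m → ℝ} (ho : o ∈ simplex m)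
    (hle : ∀ j, o j ≤ 1 / ((m : ℝ) - 1)) : dist1 (axisPoint z 0) o = 2 * o z := by
  have h1 := one_lt_cast_of_two_le hm
  have h2 : (m : ℝ) - 1 ≠ 0 := by linarith
  have key : ∀ j, |axisPoint z 0 j - o j| =
      axisPoint z 0 j - o j + if j = z then 2 * o z else 0 := by
    intro j
    by_cases hj : j = z
    · subst hj
      rw [axisPoint_self, if_pos rfl, zero_sub, abs_neg, abs_of_nonneg (ho.1 j)]
      ring
    · rw [axisPoint_of_ne _ hj, if_neg hj, sub_zero, add_zero,
        abs_of_nonneg (sub_nonneg.2 (hle j))]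
  unfold dist1
  simp_rw [key, Finset.sum_add_distrib, Finset.sum_sub_distrib]
  rw [(axisPoint_mem_simplex hm z (t := 0) (by simp)).2, ho.2]
  simp

lemma eq_axisPoint_of_invariant {m : ℕ} (hm : 2 ≤ m) (z : Fin m) {o : Fin m → ℝ}
    (ho : o ∈ simplex m) (hinv : ∀ σ : Equiv.Perm (Fin m), σ z = z → (fun j => o (σ j)) = o) :
    o = axisPoint z (o z) := by
  have h1 := one_lt_cast_of_two_le hm
  have h2 : (m : ℝ) - 1 ≠ 0 := by linarith
  funext j
  by_cases hj : j = z
  · rw [hj, axisPoint_self]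
  · have hc : ∀ k, k ≠ z → o k = o j := fun k hk => by
      have := congrFun (hinv (Equiv.swap j k) (Equiv.swap_apply_of_ne_of_ne (Ne.symm hj)
        (Ne.symm hk))) j
      simpa using this
    have hs := ho.2
    rw [sum_eq_add_mul z _ _ hc] at hs
    rw [axisPoint_of_ne _ hj, eq_div_iff h2]
    linarith

/-- A coalition of voters sharing the same report does not gain by a common misreport. -/
lemma Truthful.coalition {n m : ℕ} {A : (Fin n → Fin m → ℝ) → (Fin m → ℝ)} (hA : Truthful A)
    {p q : Fin m → ℝ} (hq : q ∈ simplex m) {R : Fin n → Fin m → ℝ}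
    (hR : ∀ i, R i ∈ simplex m) (S : Finset (Fin n)) (hS : ∀ i ∈ S, R i = p) :
    dist1 p (A R) ≤ dist1 p (A fun i => if i ∈ S then q else R i) := by
  induction S using Finset.induction_on with
  | empty => simp
  | insert a S ha ih =>
    refine (ih fun i hi => hS i (Finset.mem_insert_of_mem hi)).trans ?_
    have h := hA (fun i => if i ∈ S then q else R i)
      (fun i => by split_ifs <;> [exact hq; exact hR i]) a q hq
    simp only [if_neg ha, hS a (Finset.mem_insert_self a S)] at h
    have hupd : (fun i => if i ∈ insert a S then q else R i) =
        Function.update (fun i => if i ∈ S then q else R i) a q := by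
      funext i
      by_cases hi : i = a
      · subst hi; simp
      · simp [Finset.mem_insert, hi]
    rw [hupd]
    exact h

/-- A two-voter mechanism that is symmetric, truthful, neutral and continuous outputs the uniform
vector when one voter reports it and the other reports a vertex. -/
lemma two_voter_uniform_vertex {m : ℕ} (hm : 2 ≤ m) (z : Fin m)
    (B : (Fin m → ℝ) → (Fin m → ℝ) → (Fin m → ℝ))
    (hmap : ∀ p ∈ simplex m, ∀ q ∈ simplex m, B p q ∈ simplex m)
    (hsymm : ∀ p ∈ simplex m, ∀ q ∈ simplex m, B p q = B q p)
    (htruth : ∀ p ∈ simplex m, ∀ p' ∈ simplex m, ∀ q ∈ simplex m,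
      dist1 p (B p q) ≤ dist1 p (B p' q))
    (hneut : ∀ p ∈ simplex m, ∀ q ∈ simplex m, ∀ σ : Equiv.Perm (Fin m),
      B (fun j => p (σ j)) (fun j => q (σ j)) = fun j => B p q (σ j))
    (hcont : ∀ q ∈ simplex m, ContinuousOn (fun p => B p q) (simplex m)) :
    B (fun _ => (1 : ℝ) / m) (axisPoint z 1) = fun _ => (1 : ℝ) / m := by
  have h1 := one_lt_cast_of_two_le hm
  have h2 : (0 : ℝ) < m - 1 := by linarith
  have hu : (1 : ℝ) / m ∈ Set.Icc (0 : ℝ) 1 :=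
    ⟨by positivity, by rw [div_le_one (by linarith)]; exact h1.le⟩
  have hz : (0 : ℝ) ∈ Set.Icc (0 : ℝ) 1 := by simp
  have ho : (1 : ℝ) ∈ Set.Icc (0 : ℝ) 1 := by simp
  have hmem : ∀ {t : ℝ}, t ∈ Set.Icc (0 : ℝ) 1 → axisPoint z t ∈ simplex m :=
    fun ht => axisPoint_mem_simplex hm z ht
  have hunif := axisPoint_inv_card hm z
  set c : ℝ → ℝ → ℝ := fun s t => B (axisPoint z s) (axisPoint z t) z with hc
  have hBc : ∀ s ∈ Set.Icc (0 : ℝ) 1, ∀ t ∈ Set.Icc (0 : ℝ) 1,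
      B (axisPoint z s) (axisPoint z t) = axisPoint z (c s t) := by
    intro s hs t ht
    refine eq_axisPoint_of_invariant hm z (hmap _ (hmem hs) _ (hmem ht)) fun σ hσ => ?_
    rw [← hneut _ (hmem hs) _ (hmem ht) σ, axisPoint_comp z s hσ, axisPoint_comp z t hσ]
  have hcsymm : ∀ s ∈ Set.Icc (0 : ℝ) 1, ∀ t ∈ Set.Icc (0 : ℝ) 1, c s t = c t s := by
    intro s hs t ht
    simp only [hc]
    rw [hsymm _ (hmem hs) _ (hmem ht)]
  have hctruth : ∀ s ∈ Set.Icc (0 : ℝ) 1, ∀ s' ∈ Set.Icc (0 : ℝ) 1, ∀ t ∈ Set.Icc (0 : ℝ) 1,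
      |s - c s t| ≤ |s - c s' t| := by
    intro s hs s' hs' t ht
    have h := htruth _ (hmem hs) _ (hmem hs') _ (hmem ht)
    rw [hBc s hs t ht, hBc s' hs' t ht, dist1_axisPoint hm, dist1_axisPoint hm] at h
    linarith
  have hccont : ∀ t ∈ Set.Icc (0 : ℝ) 1, ContinuousOn (fun s => c s t) (Set.Icc 0 1) := by
    intro t ht
    exact (continuous_apply z).comp_continuousOn
      ((hcont _ (hmem ht)).comp (continuous_axisPoint z).continuousOn fun s hs => hmem hs)
  have hcmem : ∀ s ∈ Set.Icc (0 : ℝ) 1, ∀ t ∈ Set.Icc (0 : ℝ) 1, 0 ≤ c s t ∧ c s t ≤ 1 := by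
    intro s hs t ht
    have hS := hmap _ (hmem hs) _ (hmem ht)
    exact ⟨hS.1 z, hS.2 ▸ Finset.single_le_sum (fun j _ => hS.1 j) (Finset.mem_univ z)⟩
  -- a bloc moving to the current outcome does not change it
  have hstay : ∀ s ∈ Set.Icc (0 : ℝ) 1, ∀ t ∈ Set.Icc (0 : ℝ) 1, c s t = 1 / m →
      c (1 / m) t = 1 / m := by
    intro s hs t ht h
    have := hctruth _ hu s hs t ht
    rw [h, sub_self, abs_zero] at this
    linarith [abs_nonpos_iff.1 this]
  have huu : c (1 / m) (1 / m) = 1 / m := by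
    have hS := hmap _ (hmem hu) _ (hmem hu)
    have hconst : ∀ j, j ≠ z → B (axisPoint z (1 / m)) (axisPoint z (1 / m)) j =
        c (1 / m) (1 / m) := by
      intro j _
      have h := congrFun (hneut _ (hmem hu) _ (hmem hu) (Equiv.swap z j)) z
      rw [hunif] at h
      simp only [Equiv.swap_apply_left] at h
      simp only [hc, hunif]
      exact h.symm
    have hs := hS.2
    rw [sum_eq_add_mul z _ _ hconst] at hs
    rw [eq_div_iff (by linarith)]
    have : B (axisPoint z (1 / m)) (axisPoint z (1 / m)) z = c (1 / m) (1 / m) := rfl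
    rw [this] at hs
    linarith
  have hge : 1 / (m : ℝ) ≤ c (1 / m) 1 := by
    have h := hctruth 1 ho _ hu _ hu
    rw [huu, hcsymm 1 ho _ hu, abs_of_nonneg (by linarith [(hcmem _ hu 1 ho).2]),
      abs_of_nonneg (by linarith [hu.2])] at h
    linarith
  suffices h : c (1 / m) 1 = 1 / m by
    have hB := hBc _ hu 1 ho
    rwa [h, hunif] at hB
  rcases le_total (c 0 1) (1 / m) with hv | hv
  · obtain ⟨s, hs, hs'⟩ := intermediate_value_Icc hu.1
      ((hccont 1 ho).mono (Set.Icc_subset_Icc_right hu.2)) ⟨hv, hge⟩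
    exact hstay s ⟨hs.1, hs.2.trans hu.2⟩ 1 ho hs'
  · have hle : c (1 / m) 0 ≤ 1 / m := by
      have h := hctruth 0 hz _ hu _ hu
      rw [huu, hcsymm 0 hz _ hu, zero_sub, zero_sub, abs_neg, abs_neg, abs_of_nonneg hu.1,
        abs_of_nonneg (hcmem _ hu 0 hz).1] at h
      exact h
    rw [hcsymm 0 hz 1 ho] at hv
    obtain ⟨t, ht, ht'⟩ := intermediate_value_Icc hu.2
      ((hccont 0 hz).mono (Set.Icc_subset_Icc_left hu.1)) ⟨hle, hv⟩
    have hu0 : c (1 / m) 0 = 1 / m := hstay t ⟨hu.1.trans ht.1, ht.2⟩ 0 hz ht'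
    by_contra hne
    have hgt : 1 / (m : ℝ) < c 1 (1 / m) := by
      rw [hcsymm 1 ho _ hu]
      exact lt_of_le_of_ne hge (Ne.symm hne)
    have hlt : 1 / (m : ℝ) < 1 / (m - 1) :=
      one_div_lt_one_div_of_lt h2 (by linarith)
    set y : ℝ := min (c 1 (1 / m)) (1 / (m - 1)) with hy
    have hy1 : 1 / (m : ℝ) < y := lt_min hgt hlt
    obtain ⟨s, hs, hsy⟩ := intermediate_value_Icc hu.2
      ((hccont _ hu).mono (Set.Icc_subset_Icc_left hu.1))
      (show y ∈ Set.Icc (c (1 / m) (1 / m)) (c 1 (1 / m)) from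
        ⟨huu.symm ▸ hy1.le, min_le_left _ _⟩)
    have hs01 : s ∈ Set.Icc (0 : ℝ) 1 := ⟨hu.1.trans hs.1, hs.2⟩
    have : Nontrivial (Fin m) := Fin.nontrivial_iff_two_le.2 hm
    obtain ⟨w, hw⟩ := exists_ne z
    have hsw : (fun j => axisPoint z s (Equiv.swap z w j)) ∈ simplex m :=
      ⟨fun j => (hmem hs01).1 _,
        (Equiv.sum_comp (Equiv.swap z w) (axisPoint z s)).trans (hmem hs01).2⟩
    have hout : B (fun j => axisPoint z s (Equiv.swap z w j)) (axisPoint z (1 / m)) =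
        fun j => axisPoint z y (Equiv.swap z w j) := by
      have h := hneut _ (hmem hs01) _ (hmem hu) (Equiv.swap z w)
      rw [hBc s hs01 _ hu] at h
      rw [hunif] at h ⊢
      rw [h, ← hsy]
    have hdev := htruth _ (hmem hz) _ hsw _ (hmem hu)
    rw [hout, hBc 0 hz _ hu, dist1_axisPoint hm, hcsymm 0 hz _ hu, hu0,
      dist1_axisPoint_zero hm z (hout ▸ hmap _ hsw _ (hmem hu)), Equiv.swap_apply_left,
      axisPoint_of_ne _ hw, zero_sub, abs_neg, abs_of_nonneg hu.1] at hdev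
    · have h3 : (1 - y) / ((m : ℝ) - 1) < 1 / m := by
        rw [div_lt_iff₀ h2]
        have : 1 / (m : ℝ) * (m - 1) = 1 - 1 / m := by field_simp
        linarith
      linarith
    · intro j
      by_cases hj : Equiv.swap z w j = z
      · rw [hj, axisPoint_self]
        exact min_le_right _ _
      · rw [axisPoint_of_ne _ hj]
        exact div_le_div_of_nonneg_right (by linarith [hu.1]) h2.le

lemma twoBlocs_profile_mem {n m : ℕ} {p q : Fin m → ℝ} (hp : p ∈ simplex m)
    (hq : q ∈ simplex m) (i : Fin n) : (if (i : ℕ) < n / 2 then p else q) ∈ simplex m := by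
  split_ifs <;> assumption

lemma twoBlocs_symm {n m : ℕ} (hn : Even n) {A : (Fin n → Fin m → ℝ) → (Fin m → ℝ)}
    (hA : Anonymous A) {p q : Fin m → ℝ} (hp : p ∈ simplex m) (hq : q ∈ simplex m) :
    twoBlocs A p q = twoBlocs A q p := by
  unfold twoBlocs
  rw [← hA _ (twoBlocs_profile_mem hq hp) Fin.revPerm]
  congr 1
  funext i
  obtain ⟨k, rfl⟩ := hn
  have hi := i.isLt
  by_cases h : (i : ℕ) < (k + k) / 2
  · rw [if_pos h, if_neg (by simp only [Fin.revPerm_apply, Fin.val_rev]; omega)]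
  · rw [if_neg h, if_pos (by simp only [Fin.revPerm_apply, Fin.val_rev]; omega)]

lemma twoBlocs_truthful {n m : ℕ} {A : (Fin n → Fin m → ℝ) → (Fin m → ℝ)}
    (hA : Truthful A) {p p' q : Fin m → ℝ} (hp : p ∈ simplex m) (hp' : p' ∈ simplex m)
    (hq : q ∈ simplex m) : dist1 p (twoBlocs A p q) ≤ dist1 p (twoBlocs A p' q) := by
  have h := hA.coalition (p := p) hp' (twoBlocs_profile_mem (n := n) hp hq)
    (Finset.univ.filter fun i : Fin n => (i : ℕ) < n / 2) (fun i hi => by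
      rw [if_pos (Finset.mem_filter.1 hi).2])
  have hprof : (fun i : Fin n => if i ∈ Finset.univ.filter (fun i : Fin n => (i : ℕ) < n / 2)
      then p' else if (i : ℕ) < n / 2 then p else q) =
      fun i : Fin n => if (i : ℕ) < n / 2 then p' else q := by
    funext i
    by_cases hi : (i : ℕ) < n / 2 <;> simp [hi]
  rwa [hprof] at h

lemma twoBlocs_neutral {n m : ℕ} {A : (Fin n → Fin m → ℝ) → (Fin m → ℝ)}
    (hA : Neutral A) {p q : Fin m → ℝ} (hp : p ∈ simplex m) (hq : q ∈ simplex m)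
    (σ : Equiv.Perm (Fin m)) :
    twoBlocs A (fun j => p (σ j)) (fun j => q (σ j)) = fun j => twoBlocs A p q (σ j) := by
  unfold twoBlocs
  rw [← hA _ (twoBlocs_profile_mem hp hq) σ]
  congr 1
  funext i j
  split_ifs <;> rfl

lemma twoBlocs_continuousOn {n m : ℕ} {A : (Fin n → Fin m → ℝ) → (Fin m → ℝ)}
    (hA : ContinuousOn A {P : Fin n → Fin m → ℝ | ∀ i, P i ∈ simplex m})
    {q : Fin m → ℝ} (hq : q ∈ simplex m) :
    ContinuousOn (fun p => twoBlocs A p q) (simplex m) := by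
  refine hA.comp (Continuous.continuousOn (continuous_pi fun i => ?_))
    fun p hp => twoBlocs_profile_mem hp hq
  split_ifs <;> fun_prop

lemma mean_twoBlocs {n m : ℕ} (hn : 2 ≤ n) (hneven : Even n) (p q : Fin m → ℝ) :
    mean (fun i : Fin n => if (i : ℕ) < n / 2 then p else q) = fun j => (p j + q j) / 2 := by
  funext j
  obtain ⟨k, rfl⟩ := hneven
  have hk : (k : ℝ) ≠ 0 := by
    have : k ≠ 0 := by omega
    exact_mod_cast this
  unfold mean
  have hhalf : (k + k) / 2 = k := by omega
  simp only [hhalf, Fin.sum_univ_add, Fin.val_castAdd, Fin.is_lt, if_true, Fin.val_natAdd,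
    add_lt_iff_neg_left, not_lt_zero, if_false, Finset.sum_const, Finset.card_univ,
    Fintype.card_fin, nsmul_eq_mul, Nat.cast_add]
  field_simp
  ring

/-- for even n, on the profile where n/2 voters report the uniform
vector and n/2 voters report e₁, every truthful, anonymous, neutral and continuous
mechanism outputs the uniform vector, which is at ℓ1-distance (m-1)/m and
ℓ∞-distance (m-1)/(2m) from the mean. -/
theorem stmt0 (m n : ℕ) (hm : 2 ≤ m) (hn : 2 ≤ n) (hneven : Even n)
    (A : (Fin n → Fin m → ℝ) → (Fin m → ℝ))
    (hmap : ∀ P : Fin n → Fin m → ℝ, (∀ i, P i ∈ simplex m) → A P ∈ simplex m)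
    (htruth : Truthful A)
    (hanon : Anonymous A)
    (hneut : Neutral A)
    (hcont : ContinuousOn A {P : Fin n → Fin m → ℝ | ∀ i, P i ∈ simplex m})
    (u e₁ : Fin m → ℝ)
    (hu : u = fun _ => (1 : ℝ) / m)
    (he₁ : e₁ = fun j : Fin m => if (j : ℕ) = 0 then 1 else 0)
    (P : Fin n → Fin m → ℝ)
    (hP : P = fun i : Fin n => if (i : ℕ) < n / 2 then u else e₁) :
    A P = u ∧
    dist1 (A P) (mean P) = ((m : ℝ) - 1) / m ∧
    distInf (A P) (mean P) = ((m : ℝ) - 1) / (2 * m) := by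
  have h1 := one_lt_cast_of_two_le hm
  have h2 : (m : ℝ) - 1 ≠ 0 := by linarith
  set z : Fin m := ⟨0, by omega⟩ with hz
  have he : e₁ = axisPoint z 1 := by
    rw [he₁]
    funext j
    simp [axisPoint, hz, Fin.ext_iff]
  have hAP : A P = u := by
    rw [hP, he, hu]
    exact two_voter_uniform_vertex hm z (twoBlocs A)
      (fun p hp q hq => hmap _ (twoBlocs_profile_mem hp hq))
      (fun p hp q hq => twoBlocs_symm hneven hanon hp hq)
      (fun p hp p' hp' q hq => twoBlocs_truthful htruth hp hp' hq)
      (fun p hp q hq σ => twoBlocs_neutral hneut hp hq σ)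
      (fun q hq => twoBlocs_continuousOn hcont hq)
  have hdiff : ∀ j, |A P j - mean P j| = |u j - e₁ j| / 2 := by
    intro j
    rw [hAP, hP, mean_twoBlocs hn hneven, ← abs_of_pos (two_pos (α := ℝ)), ← abs_div,
      abs_of_pos (two_pos (α := ℝ))]
    ring_nf
  have habs : |1 / (m : ℝ) - 1| = 1 - 1 / m := by
    rw [abs_sub_comm, abs_of_nonneg]
    rw [sub_nonneg, div_le_one (by linarith)]
    exact h1.le
  refine ⟨hAP, ?_, ?_⟩
  · have hd := dist1_axisPoint hm z (1 / m) 1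
    rw [axisPoint_inv_card hm z, ← hu, ← he, habs] at hd
    unfold dist1 at hd ⊢
    simp_rw [hdiff]
    rw [← Finset.sum_div, hd]
    field_simp
  · unfold distInf
    simp_rw [hdiff]
    have hval : |u z - e₁ z| / 2 = ((m : ℝ) - 1) / (2 * m) := by
      rw [he, axisPoint_self, hu, habs]
      field_simp
    have : Nonempty (Fin m) := ⟨z⟩
    refine le_antisymm (ciSup_le fun j => ?_) ?_
    · by_cases hj : j = z
      · rw [hj, hval]
      · rw [he, axisPoint_of_ne _ hj, hu, sub_self, zero_div, sub_zero, abs_of_nonneg (by positivity),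
          div_div, mul_comm (m : ℝ) 2]
        have : (2 : ℝ) ≤ m := by exact_mod_cast hm
        exact div_le_div_of_nonneg_right (by linarith) (by positivity)
    · rw [← hval]
      exact le_ciSup (f := fun j => |u j - e₁ j| / 2) (Set.finite_range _).bddAbove z
end

section
/- Fix n ≥ 1 and m ≥ 2, and let A : (Δ^{m−1})^n → Δ^{m−1} be a mechanism that is truthful, neutral, and continuous. Then for all α_1, …, α_n ∈ [0,1] there exists γ ∈ [0,1] such that A(p(α_1), …, p(α_n)) = p(γ). -/
open scoped Classical BigOperators

/-- The symmetric vote p(α) = (α, (1-α)/(m-1), …, (1-α)/(m-1)). -/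
noncomputable def pvec (m : ℕ) (α : ℝ) : Fin m → ℝ :=
  fun j => if (j : ℕ) = 0 then α else (1 - α) / ((m : ℝ) - 1)

lemma pvec_mem_simplex {m : ℕ} (hm : 2 ≤ m) {α : ℝ} (hα : α ∈ Set.Icc (0 : ℝ) 1) :
    pvec m α ∈ simplex m := by
  obtain ⟨k, rfl⟩ : ∃ k, m = k + 2 := ⟨m - 2, by omega⟩
  have hk : (0 : ℝ) < ((k + 2 : ℕ) : ℝ) - 1 := by push_cast; linarith [k.cast_nonneg (α := ℝ)]
  refine ⟨fun j => ?_, ?_⟩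
  · unfold pvec
    split_ifs
    · exact hα.1
    · exact div_nonneg (sub_nonneg.2 hα.2) hk.le
  · rw [Fin.sum_univ_succ]
    simp only [pvec, Fin.val_zero, Fin.val_succ, if_true, Nat.succ_ne_zero, if_false,
      Finset.sum_const, Finset.card_univ, Fintype.card_fin, nsmul_eq_mul]
    push_cast at hk ⊢
    field_simp
    ring

lemma pvec_swap {m : ℕ} (α : ℝ) {a b : Fin m} (ha : (a : ℕ) ≠ 0) (hb : (b : ℕ) ≠ 0)
    (j : Fin m) : pvec m α (Equiv.swap a b j) = pvec m α j := by
  unfold pvec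
  rcases eq_or_ne j a with rfl | hja
  · simp [ha, hb]
  rcases eq_or_ne j b with rfl | hjb
  · simp [ha, hb]
  rw [Equiv.swap_apply_of_ne_of_ne hja hjb]

/-- A point of the simplex whose coordinates other than the first agree is some `pvec m γ`. -/
lemma exists_eq_pvec {m : ℕ} (hm : 2 ≤ m) {x : Fin m → ℝ} (hx : x ∈ simplex m)
    (hconst : ∀ a b : Fin m, (a : ℕ) ≠ 0 → (b : ℕ) ≠ 0 → x a = x b) :
    ∃ γ ∈ Set.Icc (0 : ℝ) 1, x = pvec m γ := by
  obtain ⟨k, rfl⟩ : ∃ k, m = k + 2 := ⟨m - 2, by omega⟩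
  obtain ⟨hnonneg, hsum⟩ := hx
  refine ⟨x 0, ⟨hnonneg 0, hsum ▸ Finset.single_le_sum (fun j _ => hnonneg j)
    (Finset.mem_univ 0)⟩, funext fun j => ?_⟩
  unfold pvec
  split_ifs with hj
  · rw [show j = 0 from Fin.ext hj]
  · rw [Fin.sum_univ_succ, Finset.sum_congr rfl fun i _ => hconst i.succ j (by simp) hj] at hsum
    simp only [Finset.sum_const, Finset.card_univ, Fintype.card_fin, nsmul_eq_mul] at hsum
    have hk : (0 : ℝ) < (k : ℝ) + 1 := by positivity
    push_cast at hsum ⊢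
    rw [eq_div_iff (by linarith)]
    linarith

/-- on profiles whose votes all lie on the segment α ↦ p(α),
any truthful, neutral and continuous mechanism outputs a point p(γ) of the
same segment. -/
theorem stmt2 (n m : ℕ) (hn : 1 ≤ n) (hm : 2 ≤ m)
    (A : (Fin n → Fin m → ℝ) → (Fin m → ℝ))
    (hmap : ∀ P : Fin n → Fin m → ℝ, (∀ i, P i ∈ simplex m) → A P ∈ simplex m)
    (htruth : Truthful A)
    (hneut : Neutral A)
    (hcont : ContinuousOn A {P : Fin n → Fin m → ℝ | ∀ i, P i ∈ simplex m})
    (α : Fin n → ℝ) (hα : ∀ i, α i ∈ Set.Icc (0 : ℝ) 1) :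
    ∃ γ ∈ Set.Icc (0 : ℝ) 1, A (fun i => pvec m (α i)) = pvec m γ := by
  have hP : ∀ i, pvec m (α i) ∈ simplex m := fun i => pvec_mem_simplex hm (hα i)
  refine exists_eq_pvec hm (hmap _ hP) fun a b ha hb => ?_
  have h := congrFun (hneut _ hP (Equiv.swap a b)) a
  simpa only [pvec_swap _ ha hb, Equiv.swap_apply_left] using h
end

section
/- Let a, a*, v ∈ Δ² (i.e., vectors in ℝ³ with nonnegative entries summing to 1). If there exist two distinct indices i ∈ {1,2,3} such that (a*_i ≥ a_i ≥ v_i) or (a*_i ≤ a_i ≤ v_i), then ‖a − v‖₁ ≤ ‖a* − v‖₁. -/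
open scoped BigOperators

/-- If two numbers move away from `0` without changing sign, then the sum of their absolute values
and of the absolute value of their sum does not decrease. -/
theorem abs_add_abs_add_abs_add_le {p q P Q : ℝ}
    (hp : (p ≤ P ∧ 0 ≤ p) ∨ (P ≤ p ∧ p ≤ 0)) (hq : (q ≤ Q ∧ 0 ≤ q) ∨ (Q ≤ q ∧ q ≤ 0)) :
    |p| + |q| + |p + q| ≤ |P| + |Q| + |P + Q| := by
  have hP := le_abs_self P
  have hP' := neg_le_abs P
  have hQ := le_abs_self Q
  have hQ' := neg_le_abs Q
  have hPQ := le_abs_self (P + Q)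
  have hPQ' := neg_le_abs (P + Q)
  rcases hp with ⟨h₁, h₂⟩ | ⟨h₁, h₂⟩ <;> rcases hq with ⟨h₃, h₄⟩ | ⟨h₃, h₄⟩ <;>
    rcases abs_cases p with ⟨e₁, -⟩ | ⟨e₁, -⟩ <;> rcases abs_cases q with ⟨e₂, -⟩ | ⟨e₂, -⟩ <;>
    rcases abs_cases (p + q) with ⟨e₃, -⟩ | ⟨e₃, -⟩ <;> linarith

/-- if on two distinct coordinates a lies (weakly) between a* and v,
then a is ℓ1-closer to v than a* is. -/
theorem stmt5 (a astar v : Fin 3 → ℝ)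
    (ha : a ∈ simplex 3) (hastar : astar ∈ simplex 3) (hv : v ∈ simplex 3)
    (h : ∃ i j : Fin 3, i ≠ j ∧
      ((a i ≤ astar i ∧ v i ≤ a i) ∨ (astar i ≤ a i ∧ a i ≤ v i)) ∧
      ((a j ≤ astar j ∧ v j ≤ a j) ∨ (astar j ≤ a j ∧ a j ≤ v j))) :
    dist1 a v ≤ dist1 astar v := by
  obtain ⟨i, j, hij, hi, hj⟩ := h
  obtain ⟨k, hki, hkj⟩ : ∃ k : Fin 3, k ≠ i ∧ k ≠ j := by
    clear hi hj hij
    decide +revert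
  have sum_eq (f : Fin 3 → ℝ) : ∑ l, f l = f i + f j + f k := by
    have huniv : (Finset.univ : Finset (Fin 3)) = {i, j, k} := by
      revert hij hki hkj
      clear hi hj
      decide +revert
    rw [huniv, Finset.sum_insert (by simp [hij, hki.symm]), Finset.sum_pair hkj.symm, add_assoc]
  have ha' := ha.2
  have hs' := hastar.2
  have hv' := hv.2
  rw [sum_eq] at ha' hs' hv'
  have hk : |a k - v k| = |(a i - v i) + (a j - v j)| := by
    rw [← abs_neg]; congr 1; linarith
  have hk' : |astar k - v k| = |(astar i - v i) + (astar j - v j)| := by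
    rw [← abs_neg]; congr 1; linarith
  rw [dist1, dist1, sum_eq, sum_eq, hk, hk']
  apply abs_add_abs_add_abs_add_le
  · simpa using hi
  · simpa using hj
end

section
/- Let m ≥ 2, n ≥ 1, and let P = (p_1,…,p_n) be a profile in (Δ^{m−1})^n. Then there exists a GreedyMax normalization time t ∈ [1/m, 1]; moreover, if t and t' are both GreedyMax normalization times for P, then min(t, max_{i ∈ [n]} p_{i,j}) = min(t', max_{i ∈ [n]} p_{i,j}) for every j ∈ {1,…,m}, i.e., the GreedyMax aggregate is unique. -/
open scoped Classical BigOperators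

/-- GreedyMax aggregate at time t: coordinate j gets min(t, max_i p_{i,j}). -/
noncomputable def gmaxAgg {n m : ℕ} (P : Fin n → Fin m → ℝ) (t : ℝ) : Fin m → ℝ :=
  fun j => min t (⨆ i, P i j)

/-- t is a GreedyMax normalization time if t ∈ [0,1] and the aggregate sums to 1. -/
noncomputable def IsGmaxNormTime {n m : ℕ} (P : Fin n → Fin m → ℝ) (t : ℝ) : Prop :=
  t ∈ Set.Icc (0 : ℝ) 1 ∧ ∑ j, gmaxAgg P t j = 1

theorem gmaxAgg_mono {n m : ℕ} (P : Fin n → Fin m → ℝ) : Monotone (gmaxAgg P) :=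
  fun _ _ h _ => min_le_min_right _ h

theorem continuous_gmaxAgg {n m : ℕ} (P : Fin n → Fin m → ℝ) : Continuous (gmaxAgg P) :=
  continuous_pi fun _ => continuous_id.min continuous_const

theorem sum_gmaxAgg_one_div_le {n m : ℕ} (P : Fin n → Fin m → ℝ) :
    ∑ j, gmaxAgg P (1 / m) j ≤ 1 :=
  calc ∑ j, gmaxAgg P (1 / m) j ≤ ∑ _j : Fin m, (1 / m : ℝ) :=
        Finset.sum_le_sum fun _ _ => min_le_left _ _
    _ ≤ 1 := by simpa using mul_inv_le_one (a := (m : ℝ))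

theorem one_le_sum_gmaxAgg_one {n m : ℕ} (P : Fin n → Fin m → ℝ) (i : Fin n)
    (hi : P i ∈ simplex m) : 1 ≤ ∑ j, gmaxAgg P 1 j := by
  rw [← hi.2]
  refine Finset.sum_le_sum fun j _ => le_min ?_ ?_
  · exact Finset.single_le_sum (fun k _ => hi.1 k) (Finset.mem_univ j)
  · exact le_ciSup (f := fun i => P i j) (Set.finite_range _).bddAbove i

theorem gmaxAgg_eq_of_sum_eq {n m : ℕ} (P : Fin n → Fin m → ℝ) {t t' : ℝ}
    (h : ∑ j, gmaxAgg P t j = ∑ j, gmaxAgg P t' j) : gmaxAgg P t = gmaxAgg P t' := by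
  wlog htt : t ≤ t' generalizing t t'
  · exact (this h.symm (le_of_not_ge htt)).symm
  · exact funext fun j =>
      (Finset.sum_eq_sum_iff_of_le fun k _ => gmaxAgg_mono P htt k).1 h j (Finset.mem_univ j)

/-- a GreedyMax normalization time always exists in [1/m, 1], and
the GreedyMax aggregate is independent of the choice of normalization time. -/
theorem stmt6 (m n : ℕ) (hm : 2 ≤ m) (hn : 1 ≤ n)
    (P : Fin n → Fin m → ℝ) (hP : ∀ i, P i ∈ simplex m) :
    (∃ t ∈ Set.Icc ((1 : ℝ) / m) 1, IsGmaxNormTime P t) ∧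
    (∀ t t' : ℝ, IsGmaxNormTime P t → IsGmaxNormTime P t' →
      ∀ j, gmaxAgg P t j = gmaxAgg P t' j) := by
  refine ⟨?_, fun t t' ht ht' => congrFun (gmaxAgg_eq_of_sum_eq P (ht.2.trans ht'.2.symm))⟩
  have hm1 : (1 : ℝ) / m ≤ 1 := by
    simpa using Nat.cast_inv_le_one (α := ℝ) m
  have hcont : Continuous fun t => ∑ j, gmaxAgg P t j :=
    continuous_finsetSum _ fun j _ => (continuous_apply j).comp (continuous_gmaxAgg P)
  obtain ⟨t, ht, hsum⟩ := intermediate_value_Icc hm1 hcont.continuousOn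
    ⟨sum_gmaxAgg_one_div_le P, one_le_sum_gmaxAgg_one P ⟨0, hn⟩ (hP _)⟩
  exact ⟨t, ht, ⟨(by positivity : (0 : ℝ) ≤ 1 / m).trans ht.1, ht.2⟩, hsum⟩
end

section
/- Let m ≥ 2, n ≥ 1, let P = (p_1,…,p_n) be a profile in (Δ^{m−1})^n, let t ∈ [0,1] and j ∈ {1,…,m}. Then min(t, max_{i ∈ [n]} p_{i,j}) is the median of the multiset of 2n+1 real numbers consisting of t with multiplicity n, the number 0 with multiplicity 1, and the n values p_{1,j}, …, p_{n,j}. -/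
open scoped Classical BigOperators

/-- x is the median of a multiset M of 2k+1 reals: x ∈ M, at least k+1 elements of M
are ≤ x, and at least k+1 elements of M are ≥ x. -/
def IsMedian (M : Multiset ℝ) (k : ℕ) (x : ℝ) : Prop :=
  x ∈ M ∧ k + 1 ≤ (M.filter fun y => y ≤ x).card ∧ k + 1 ≤ (M.filter fun y => x ≤ y).card

/-- A submultiset all of whose elements satisfy `p` bounds the number of elements satisfying `p`. -/
theorem Multiset.card_le_card_filter_of_le {α : Type*} {p : α → Prop} [DecidablePred p]
    {s M : Multiset α} (hs : s ≤ M) (hp : ∀ a ∈ s, p a) : s.card ≤ (M.filter p).card :=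
  Multiset.card_le_card (Multiset.le_filter.2 ⟨hs, hp⟩)

/-- for the GreedyMax phantom system (n phantoms at t and one at 0),
the median on coordinate j equals min(t, max_i p_{i,j}). -/
theorem stmt7 (m n : ℕ) (hm : 2 ≤ m) (hn : 1 ≤ n)
    (P : Fin n → Fin m → ℝ) (hP : ∀ i, P i ∈ simplex m)
    (t : ℝ) (ht : t ∈ Set.Icc (0 : ℝ) 1) (j : Fin m) :
    IsMedian
      (Multiset.replicate n t + ({0} : Multiset ℝ) +
        (Finset.univ.val.map fun i : Fin n => P i j))
      n
      (min t (⨆ i, P i j)) := by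
  have : Nonempty (Fin n) := ⟨⟨0, hn⟩⟩
  obtain ⟨i₀, hi₀⟩ := exists_eq_ciSup_of_finite (f := fun i => P i j)
  have hle : ∀ i, P i j ≤ ⨆ i, P i j := le_ciSup (Set.finite_range _).bddAbove
  have hnonneg : 0 ≤ ⨆ i, P i j := ((hP i₀).1 j).trans (hle i₀)
  have hmem : P i₀ j ∈ Finset.univ.val.map fun i : Fin n => P i j :=
    Multiset.mem_map_of_mem _ (Finset.mem_univ i₀)
  refine ⟨?_, ?_, ?_⟩
  · rcases min_choice t (⨆ i, P i j) with h | h <;> rw [h]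
    · exact Multiset.mem_add.2 <| .inl <| Multiset.mem_add.2 <| .inl <|
        Multiset.mem_replicate.2 ⟨by lia, rfl⟩
    · exact Multiset.mem_add.2 <| .inr <| hi₀ ▸ hmem
  · rcases le_total t (⨆ i, P i j) with h | h
    · rw [min_eq_left h]
      have hcard := Multiset.card_le_card_filter_of_le (p := fun y => y ≤ t)
        (Multiset.le_add_right (Multiset.replicate n t + {0})
          (Finset.univ.val.map fun i : Fin n => P i j)) (by
            intro a ha
            rcases Multiset.mem_add.1 ha with ha | ha
            · exact (Multiset.eq_of_mem_replicate ha).le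
            · exact (Multiset.mem_singleton.1 ha).trans_le ht.1)
      simpa using hcard
    · rw [min_eq_right h, add_assoc]
      have hcard := Multiset.card_le_card_filter_of_le (p := fun y => y ≤ ⨆ i, P i j)
        (Multiset.le_add_left ({0} + Finset.univ.val.map fun i : Fin n => P i j)
          (Multiset.replicate n t)) (by
            intro a ha
            rcases Multiset.mem_add.1 ha with ha | ha
            · exact (Multiset.mem_singleton.1 ha).trans_le hnonneg
            · obtain ⟨i, -, rfl⟩ := Multiset.mem_map.1 ha
              exact hle i)
      simpa [add_comm] using hcard
  · have hcard := Multiset.card_le_card_filter_of_le (p := fun y => min t (⨆ i, P i j) ≤ y)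
      (add_le_add (Multiset.le_add_right (Multiset.replicate n t) {0})
        (Multiset.singleton_le.2 hmem)) (by
          intro a ha
          rcases Multiset.mem_add.1 ha with ha | ha
          · exact (min_le_left _ _).trans (Multiset.eq_of_mem_replicate ha).ge
          · exact (min_le_right _ _).trans (hi₀.ge.trans (Multiset.mem_singleton.1 ha).ge))
    simpa only [Multiset.card_add, Multiset.card_replicate, Multiset.card_singleton] using hcard
end

section
/- Let m ≥ 2, n ≥ 1, τ ∈ [1/2, 1), let P = (p_1,…,p_n) be a profile in (Δ^{m−1})^n, and let j ∈ {1,…,m} be such that p_{i,j} ≥ τ for all i ∈ [n] and ∑_{k ≠ j} max_{i ∈ [n]} p_{i,k} ≤ 1 − τ. Then t := 1 − ∑_{k ≠ j} max_{i ∈ [n]} p_{i,k} satisfies t ≥ τ, t is a GreedyMax normalization time for P, and the associated GreedyMax aggregate a satisfies a_k = max_{i ∈ [n]} p_{i,k} for all k ≠ j and a_j = 1 − ∑_{k ≠ j} max_{i ∈ [n]} p_{i,k}. -/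
open scoped Classical BigOperators

/-- if every voter gives at least τ to alternative j, and the maxima on
the other alternatives sum to at most 1 - τ, then t := 1 - ∑_{k ≠ j} max_i p_{i,k}
is a normalization time (≥ τ), and the GreedyMax aggregate equals the maxima on the
other alternatives and the residual on j. -/
theorem stmt8 (m n : ℕ) (hm : 2 ≤ m) (hn : 1 ≤ n)
    (τ : ℝ) (hτ : τ ∈ Set.Ico (1 / 2 : ℝ) 1)
    (P : Fin n → Fin m → ℝ) (hP : ∀ i, P i ∈ simplex m)
    (j : Fin m) (hj : ∀ i, τ ≤ P i j)
    (hsum : ∑ k ∈ Finset.univ.erase j, (⨆ i, P i k) ≤ 1 - τ) :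
    τ ≤ 1 - ∑ k ∈ Finset.univ.erase j, (⨆ i, P i k) ∧
    IsGmaxNormTime P (1 - ∑ k ∈ Finset.univ.erase j, (⨆ i, P i k)) ∧
    (∀ k, k ≠ j →
      gmaxAgg P (1 - ∑ k' ∈ Finset.univ.erase j, (⨆ i, P i k')) k = ⨆ i, P i k) ∧
    gmaxAgg P (1 - ∑ k ∈ Finset.univ.erase j, (⨆ i, P i k)) j
      = 1 - ∑ k ∈ Finset.univ.erase j, (⨆ i, P i k) := by
  have bdd : ∀ k, BddAbove (Set.range fun i => P i k) := fun k => Set.finite_range _ |>.bddAbove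
  have hle : ∀ i k, P i k ≤ ⨆ i, P i k := fun i k => le_ciSup (bdd k) i
  have hnonneg : ∀ k, 0 ≤ ⨆ i, P i k := fun k => Real.iSup_nonneg fun i => (hP i).1 k
  have hresidual : 1 - ∑ k ∈ Finset.univ.erase j, (⨆ i, P i k) ≤ ⨆ i, P i j := by
    let i : Fin n := ⟨0, hn⟩
    have hsplit := Finset.add_sum_erase Finset.univ (P i) (Finset.mem_univ j)
    have hmono : ∑ k ∈ Finset.univ.erase j, P i k ≤ ∑ k ∈ Finset.univ.erase j, (⨆ i, P i k) :=
      Finset.sum_le_sum fun k _ => hle i k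
    linarith [(hP i).2, hle i j]
  have hsmall : ∀ k, k ≠ j → (⨆ i, P i k) ≤ ∑ k ∈ Finset.univ.erase j, (⨆ i, P i k) :=
    fun k hk => Finset.single_le_sum (f := fun k => ⨆ i, P i k) (fun k _ => hnonneg k)
      (Finset.mem_erase.2 ⟨hk, Finset.mem_univ k⟩)
  have hS : 0 ≤ ∑ k ∈ Finset.univ.erase j, (⨆ i, P i k) := Finset.sum_nonneg fun k _ => hnonneg k
  obtain ⟨hτ, -⟩ := hτ
  have hother : ∀ k, k ≠ j →
      gmaxAgg P (1 - ∑ k' ∈ Finset.univ.erase j, (⨆ i, P i k')) k = ⨆ i, P i k :=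
    fun k hk => min_eq_right (by linarith [hsmall k hk])
  have hself : gmaxAgg P (1 - ∑ k ∈ Finset.univ.erase j, (⨆ i, P i k)) j
      = 1 - ∑ k ∈ Finset.univ.erase j, (⨆ i, P i k) := min_eq_left hresidual
  refine ⟨by linarith, ⟨⟨by linarith, by linarith⟩, ?_⟩, hother, hself⟩
  rw [← Finset.add_sum_erase _ _ (Finset.mem_univ j), hself,
    Finset.sum_congr rfl fun k hk => hother k (Finset.ne_of_mem_erase hk)]
  ring
end

section
/- Let m ≥ 2, n ≥ 1, τ ∈ [1/2, 1), let P = (p_1,…,p_n) be a profile in (Δ^{m−1})^n, let t be a GreedyMax normalization time for P with associated GreedyMax aggregate a, and let j ∈ {1,…,m}. Then a_j > τ if and only if min_{i ∈ [n]} p_{i,j} > τ and ∑_{k ≠ j} max_{i ∈ [n]} p_{i,k} < 1 − τ. -/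
open scoped Classical BigOperators

/-- the GreedyMax aggregate gives more than τ to alternative j iff
all voters give more than τ to j and the maxima on the other alternatives sum to
less than 1 - τ. -/
theorem stmt9 (m n : ℕ) (hm : 2 ≤ m) (hn : 1 ≤ n)
    (τ : ℝ) (hτ : τ ∈ Set.Ico (1 / 2 : ℝ) 1)
    (P : Fin n → Fin m → ℝ) (hP : ∀ i, P i ∈ simplex m)
    (t : ℝ) (ht : IsGmaxNormTime P t) (j : Fin m) :
    τ < gmaxAgg P t j ↔
      (τ < ⨅ i, P i j ∧ ∑ k ∈ Finset.univ.erase j, (⨆ i, P i k) < 1 - τ) := by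
  obtain ⟨hτ₁, -⟩ := hτ
  obtain ⟨⟨ht₀, -⟩, hsum⟩ := ht
  have : Nonempty (Fin n) := ⟨⟨0, hn⟩⟩
  have le_max : ∀ i k, P i k ≤ ⨆ i, P i k := fun i k =>
    le_ciSup (f := fun i => P i k) (Set.finite_range _).bddAbove i
  have agg_nonneg : ∀ k, 0 ≤ gmaxAgg P t k := fun k =>
    le_min ht₀ (Real.iSup_nonneg fun i => (hP i).1 k)
  rw [← Finset.add_sum_erase _ _ (Finset.mem_univ j)] at hsum
  constructor
  · intro h
    have hτt : τ < t := h.trans_le (min_le_left _ _)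
    have agg_eq_max : ∀ k ∈ Finset.univ.erase j, gmaxAgg P t k = ⨆ i, P i k := by
      intro k hk
      have hle := Finset.single_le_sum (fun l _ => agg_nonneg l) hk
      exact (min_choice t (⨆ i, P i k)).resolve_left fun hkt => by
        have : gmaxAgg P t k = t := hkt
        linarith
    have hlt : ∑ k ∈ Finset.univ.erase j, (⨆ i, P i k) < 1 - τ := by
      rw [← Finset.sum_congr rfl agg_eq_max]
      linarith
    refine ⟨?_, hlt⟩
    obtain ⟨i, hi⟩ := exists_eq_ciInf_of_finite (f := fun i => P i j)
    rw [← hi]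
    have hPi := (hP i).2
    rw [← Finset.add_sum_erase _ _ (Finset.mem_univ j)] at hPi
    have hle := Finset.sum_le_sum fun k (_ : k ∈ Finset.univ.erase j) => le_max i k
    linarith
  · rintro ⟨-, hlt⟩
    have hle : ∑ k ∈ Finset.univ.erase j, gmaxAgg P t k ≤
        ∑ k ∈ Finset.univ.erase j, (⨆ i, P i k) :=
      Finset.sum_le_sum fun k _ => min_le_right _ _
    linarith
end

section
/- (Truthfulness of CutoffGreedyMax.) Let m ≥ 2, n ≥ 1, τ ∈ [1/2, 1). Let P = (p_1,…,p_n) be a profile in (Δ^{m−1})^n, let i ∈ {1,…,n}, let q ∈ Δ^{m−1}, and let P' be the profile obtained from P by replacing p_i with q. Let t and t' be GreedyMax normalization times for P and P' with associated GreedyMax aggregates a and a', respectively. Then ‖p_i − c_τ(a)‖₁ ≤ ‖p_i − c_τ(a')‖₁. -/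
open scoped Classical BigOperators

/-- The cutoff function c_τ: if some coordinate exceeds τ (on the simplex it is
unique), reduce it to τ and redistribute evenly over the other m-1 coordinates. -/
noncomputable def cutoff (m : ℕ) (τ : ℝ) (a : Fin m → ℝ) : Fin m → ℝ :=
  if h : ∃ k, τ < a k then
    fun j =>
      if j = Classical.choose h then τ
      else a j + (a (Classical.choose h) - τ) / ((m : ℝ) - 1)
  else a

theorem dist1_eq_two_mul_sum_sub {m : ℕ} {x y : Fin m → ℝ} (h : ∑ j, x j = ∑ j, y j) :
    dist1 x y = 2 * ∑ j, max (x j - y j) 0 := by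
  have e : ∀ j, |x j - y j| = 2 * max (x j - y j) 0 - (x j - y j) := by
    intro j
    rcases le_total 0 (x j - y j) with h0 | h0
    · rw [abs_of_nonneg h0, max_eq_left h0]; ring
    · rw [abs_of_nonpos h0, max_eq_right h0]; ring
  simp only [dist1, e, Finset.sum_sub_distrib, ← Finset.mul_sum, h, sub_self, sub_zero]

theorem dist1_comm {m : ℕ} (x y : Fin m → ℝ) : dist1 x y = dist1 y x :=
  Finset.sum_congr rfl fun _ _ => abs_sub_comm _ _

theorem dist1_le_of_deficit_le {m : ℕ} {p x y : Fin m → ℝ} (hx : ∑ j, x j = ∑ j, p j)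
    (hy : ∑ j, y j = ∑ j, p j) (h : ∀ j, p j ≤ x j ∨ y j ≤ x j) :
    dist1 p x ≤ dist1 p y := by
  rw [dist1_eq_two_mul_sum_sub hx.symm, dist1_eq_two_mul_sum_sub hy.symm]
  gcongr 2 * ?_
  refine Finset.sum_le_sum fun j _ => ?_
  rcases h j with h | h
  · exact max_le (by linarith [le_max_right (p j - y j) 0]) (le_max_right _ _)
  · gcongr

theorem dist1_le_of_excess_le {m : ℕ} {p x y : Fin m → ℝ} (hx : ∑ j, x j = ∑ j, p j)
    (hy : ∑ j, y j = ∑ j, p j) (h : ∀ j, x j ≤ p j ∨ x j ≤ y j) :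
    dist1 p x ≤ dist1 p y := by
  rw [dist1_comm p x, dist1_comm p y, dist1_eq_two_mul_sum_sub hx, dist1_eq_two_mul_sum_sub hy]
  gcongr 2 * ?_
  refine Finset.sum_le_sum fun j _ => ?_
  rcases h j with h | h
  · exact max_le (by linarith [le_max_right (y j - p j) 0]) (le_max_right _ _)
  · gcongr

theorem cutoff_cases (m : ℕ) (τ : ℝ) (a : Fin m → ℝ) :
    ((∀ j, a j ≤ τ) ∧ cutoff m τ a = a) ∨
      ∃ k, τ < a k ∧ cutoff m τ a = fun j =>
        if j = k then τ else a j + (a k - τ) / ((m : ℝ) - 1) := by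
  by_cases h : ∃ k, τ < a k
  · exact Or.inr ⟨Classical.choose h, Classical.choose_spec h, by rw [cutoff, dif_pos h]⟩
  · exact Or.inl ⟨by simpa using h, by rw [cutoff, dif_neg h]⟩

theorem sum_cutoff {m : ℕ} (hm : 2 ≤ m) (τ : ℝ) (a : Fin m → ℝ) :
    ∑ j, cutoff m τ a j = ∑ j, a j := by
  rcases cutoff_cases m τ a with ⟨-, h⟩ | ⟨k, -, h⟩
  · rw [h]
  · have hm1 : (m : ℝ) - 1 ≠ 0 := by
      have : (2 : ℝ) ≤ m := by exact_mod_cast hm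
      linarith
    have e : ∀ j, cutoff m τ a j = a j + (a k - τ) / ((m : ℝ) - 1)
        + if j = k then τ - a k - (a k - τ) / ((m : ℝ) - 1) else 0 := by
      intro j
      rw [h]
      by_cases hj : j = k
      · subst hj
        simp only [if_true]
        ring
      · simp [hj]
    simp only [e, Finset.sum_add_distrib, Finset.sum_const, Finset.card_univ, Fintype.card_fin,
      Finset.sum_ite_eq', Finset.mem_univ, if_true, nsmul_eq_mul]
    field_simp
    ring

theorem add_le_one_of_mem_simplex {m : ℕ} {a : Fin m → ℝ} (ha : a ∈ simplex m)
    {j k : Fin m} (hjk : j ≠ k) : a j + a k ≤ 1 := by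
  rw [← ha.2, ← Finset.sum_pair hjk]
  exact Finset.sum_le_sum_of_subset_of_nonneg (Finset.subset_univ _) fun l _ _ => ha.1 l

theorem cutoff_le {m : ℕ} (hm : 2 ≤ m) {τ : ℝ} (hτ : 1 / 2 ≤ τ) {a : Fin m → ℝ}
    (ha : a ∈ simplex m) (j : Fin m) : cutoff m τ a j ≤ τ := by
  rcases cutoff_cases m τ a with ⟨hle, h⟩ | ⟨k, hk, h⟩
  · rw [h]; exact hle j
  · rw [h]
    by_cases hj : j = k
    · simp [hj]
    · simp only [hj, if_false]
      have hm1 : (1 : ℝ) ≤ m - 1 := by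
        have : (2 : ℝ) ≤ m := by exact_mod_cast hm
        linarith
      have := div_le_self (by linarith : 0 ≤ a k - τ) hm1
      have := add_le_one_of_mem_simplex ha hj
      linarith

theorem le_iSup_profile {n m : ℕ} (P : Fin n → Fin m → ℝ) (i : Fin n) (j : Fin m) :
    P i j ≤ ⨆ i, P i j :=
  le_ciSup (f := fun i => P i j) (Set.finite_range _).bddAbove i

theorem gmaxAgg_mem_simplex {n m : ℕ} {P : Fin n → Fin m → ℝ} (hP : ∀ i, P i ∈ simplex m)
    (i : Fin n) {t : ℝ} (ht : IsGmaxNormTime P t) : gmaxAgg P t ∈ simplex m :=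
  ⟨fun j => le_min ht.1.1 (((hP i).1 j).trans (le_iSup_profile P i j)), ht.2⟩

theorem le_gmaxAgg_of_lt {n m : ℕ} {P : Fin n → Fin m → ℝ} (i : Fin n) {t : ℝ} {j : Fin m}
    (h : gmaxAgg P t j < t) : P i j ≤ gmaxAgg P t j := by
  rcases min_lt_iff.1 h with h' | h'
  · exact absurd h' (lt_irrefl _)
  · rw [gmaxAgg, min_eq_right h'.le]
    exact le_iSup_profile P i j

theorem gmaxAgg_le_or_le_update {n m : ℕ} (P : Fin n → Fin m → ℝ) (i : Fin n) (q : Fin m → ℝ)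
    {t t' : ℝ} (h : t ≤ t') (j : Fin m) :
    gmaxAgg P t j ≤ P i j ∨ gmaxAgg P t j ≤ gmaxAgg (Function.update P i q) t' j := by
  have : Nonempty (Fin n) := ⟨i⟩
  obtain ⟨l, hl⟩ := exists_eq_ciSup_of_finite (f := fun i => P i j)
  by_cases hli : l = i
  · left
    subst hli
    exact (min_le_right _ _).trans hl.ge
  · right
    refine min_le_min h ?_
    rw [← hl]
    simpa [Function.update_of_ne hli] using le_iSup_profile (Function.update P i q) l j

/-- CutoffGreedyMax is truthful. -/
theorem stmt10 (m n : ℕ) (hm : 2 ≤ m) (hn : 1 ≤ n)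
    (τ : ℝ) (hτ : τ ∈ Set.Ico (1 / 2 : ℝ) 1)
    (P : Fin n → Fin m → ℝ) (hP : ∀ i, P i ∈ simplex m)
    (i : Fin n) (q : Fin m → ℝ) (hq : q ∈ simplex m)
    (t t' : ℝ)
    (ht : IsGmaxNormTime P t)
    (ht' : IsGmaxNormTime (Function.update P i q) t') :
    dist1 (P i) (cutoff m τ (gmaxAgg P t)) ≤
      dist1 (P i) (cutoff m τ (gmaxAgg (Function.update P i q) t')) := by
  have hP' : ∀ l, Function.update P i q l ∈ simplex m := by
    intro l
    by_cases hl : l = i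
    · subst hl; simpa using hq
    · simpa [Function.update_of_ne hl] using hP l
  have ha := gmaxAgg_mem_simplex hP i ht
  have ha' := gmaxAgg_mem_simplex hP' i ht'
  have hb : ∑ j, cutoff m τ (gmaxAgg P t) j = ∑ j, P i j := by
    rw [sum_cutoff hm, ha.2, (hP i).2]
  have hb' : ∑ j, cutoff m τ (gmaxAgg (Function.update P i q) t') j = ∑ j, P i j := by
    rw [sum_cutoff hm, ha'.2, (hP i).2]
  have hm1 : (0 : ℝ) < m - 1 := by
    have : (2 : ℝ) ≤ m := by exact_mod_cast hm
    linarith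
  have hle' := cutoff_le hm hτ.1 ha'
  have hτ2 := hτ.1
  rcases cutoff_cases m τ (gmaxAgg P t) with ⟨hle, h⟩ | ⟨k, hk, h⟩
  · rw [h] at hb ⊢
    rcases lt_or_ge τ t with hτt | htτ
    · exact dist1_le_of_deficit_le hb hb' fun j =>
        Or.inl (le_gmaxAgg_of_lt i ((hle j).trans_lt hτt))
    rcases cutoff_cases m τ (gmaxAgg (Function.update P i q) t') with ⟨-, h'⟩ | ⟨k, hk, h'⟩
    · rw [h'] at hb' ⊢
      rcases le_total t t' with htt | htt
      · exact dist1_le_of_excess_le hb hb' (gmaxAgg_le_or_le_update P i q htt)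
      · refine dist1_le_of_deficit_le hb hb' fun j => ?_
        rcases lt_or_ge (gmaxAgg P t j) t with hj | hj
        · exact Or.inl (le_gmaxAgg_of_lt i hj)
        · exact Or.inr (((min_le_left _ _).trans htt).trans hj)
    · have htt : t ≤ t' := (htτ.trans hk.le).trans (min_le_left _ _)
      refine dist1_le_of_excess_le hb hb' fun j => ?_
      rcases gmaxAgg_le_or_le_update P i q htt j with hj | hj
      · exact Or.inl hj
      · right
        rw [h']
        by_cases hjk : j = k
        · simp only [hjk, if_true]
          exact hle k
        · simp only [hjk, if_false]
          have := div_nonneg (sub_nonneg.2 hk.le) hm1.le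
          linarith
  · refine dist1_le_of_deficit_le hb hb' fun j => ?_
    by_cases hjk : j = k
    · right
      have hbj : cutoff m τ (gmaxAgg P t) j = τ := by rw [h]; simp [hjk]
      rw [hbj]
      exact hle' j
    · left
      have hkt : gmaxAgg P t k ≤ t := min_le_left _ _
      have := add_le_one_of_mem_simplex ha hjk
      have := le_gmaxAgg_of_lt (P := P) (t := t) (j := j) i (by linarith)
      have := div_nonneg (sub_nonneg.2 hk.le) hm1.le
      rw [h]
      simp only [hjk, if_false]
      linarith
end

section
/- (CutoffGreedyMax is not a moving-phantom mechanism.) Let m ≥ 3, n ≥ 1, τ ∈ [1/2, 1). Let P = (p_1,…,p_n) be the profile with p_i = (1, 0, …, 0) for i ≤ n−1 and p_n = ((1+τ)/2, (1−τ)/2, 0, …, 0), and let a = (τ, (1−τ)/2 + (1−τ)/(2(m−1)), (1−τ)/(2(m−1)), …, (1−τ)/(2(m−1))). Then: (i) t = (1+τ)/2 is a GreedyMax normalization time for P, and c_τ applied to the associated GreedyMax aggregate equals a; (ii) for every phantom system (f_0,…,f_n) for n voters and every t ∈ [0,1], it is not the case that for all j ∈ {1,…,m}, a_j is the median of the multiset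 {f_0(t), …, f_n(t), p_{1,j}, …, p_{n,j}}. -/
open scoped Classical BigOperators

/-- A phantom system for n voters: n+1 continuous non-decreasing functions
[0,1] → [0,1] with f_k(0) = 0, f_k(1) = 1, ordered f_0 ≥ f_1 ≥ … ≥ f_n pointwise. -/
def IsPhantomSystem (n : ℕ) (f : Fin (n + 1) → ℝ → ℝ) : Prop :=
  (∀ k, ContinuousOn (f k) (Set.Icc 0 1)) ∧
  (∀ k, MonotoneOn (f k) (Set.Icc 0 1)) ∧
  (∀ k, Set.MapsTo (f k) (Set.Icc 0 1) (Set.Icc 0 1)) ∧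
  (∀ k, f k 0 = 0) ∧ (∀ k, f k 1 = 1) ∧
  (∀ t ∈ Set.Icc (0 : ℝ) 1, ∀ k l : Fin (n + 1), k ≤ l → f l t ≤ f k t)

/-- The 2n+1 element multiset {f_0(t), …, f_n(t), p_{1,j}, …, p_{n,j}}. -/
def phantomMS {n m : ℕ} (f : Fin (n + 1) → ℝ → ℝ) (P : Fin n → Fin m → ℝ)
    (t : ℝ) (j : Fin m) : Multiset ℝ :=
  (Finset.univ.val.map fun k => f k t) + (Finset.univ.val.map fun i => P i j)

/-- A median that exceeds every vote is bounded above by every phantom and is one of them. -/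
theorem IsMedian.phantom_of_votes_lt {n m : ℕ} {f : Fin (n + 1) → ℝ → ℝ}
    {P : Fin n → Fin m → ℝ} {t : ℝ} {j : Fin m} {x : ℝ}
    (h : IsMedian (phantomMS f P t j) n x) (hP : ∀ i, P i j < x) :
    (∀ k, x ≤ f k t) ∧ ∃ k, f k t = x := by
  obtain ⟨hmem, -, hge⟩ := h
  constructor
  · have hvotes : ((Finset.univ.val.map fun i => P i j).filter fun y => x ≤ y) = 0 := by
      rw [Multiset.filter_eq_nil]
      intro y hy
      obtain ⟨i, -, rfl⟩ := Multiset.mem_map.1 hy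
      exact not_le.2 (hP i)
    rw [phantomMS, Multiset.filter_add, hvotes, add_zero] at hge
    have hall : ((Finset.univ.val.map fun k => f k t).filter fun y => x ≤ y) =
        Finset.univ.val.map fun k => f k t :=
      Multiset.eq_of_le_of_card_le (Multiset.filter_le _ _) (by simpa using hge)
    intro k
    exact Multiset.filter_eq_self.1 hall _ (Multiset.mem_map_of_mem _ (Finset.mem_univ k))
  · rcases Multiset.mem_add.1 hmem with hx | hx
    · obtain ⟨k, -, hk⟩ := Multiset.mem_map.1 hx
      exact ⟨k, hk⟩
    · obtain ⟨i, -, hi⟩ := Multiset.mem_map.1 hx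
      exact absurd hi (hP i).ne

/-- The cutoff function when the coordinate above the threshold is known to be unique. -/
theorem cutoff_eq_of_unique {m : ℕ} {τ : ℝ} {a : Fin m → ℝ} {k : Fin m} (hk : τ < a k)
    (huniq : ∀ l, τ < a l → l = k) :
    cutoff m τ a = fun j => if j = k then τ else a j + (a k - τ) / ((m : ℝ) - 1) := by
  have h : ∃ k, τ < a k := ⟨k, hk⟩
  have hchoose : Classical.choose h = k := huniq _ (Classical.choose_spec h)
  rw [cutoff, dif_pos h, hchoose]

/-- on the profile where n-1 voters report (1,0,…,0) and one voter
reports ((1+τ)/2, (1-τ)/2, 0, …, 0), CutoffGreedyMax outputs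
(τ, (1-τ)/2 + (1-τ)/(2(m-1)), (1-τ)/(2(m-1)), …), and no moving-phantom mechanism
can produce this output. -/
theorem stmt11 (m n : ℕ) (hm : 3 ≤ m) (hn : 1 ≤ n)
    (τ : ℝ) (hτ : τ ∈ Set.Ico (1 / 2 : ℝ) 1)
    (P : Fin n → Fin m → ℝ)
    (hPdef : P = fun i : Fin n => fun j : Fin m =>
      if (i : ℕ) < n - 1 then (if (j : ℕ) = 0 then 1 else 0)
      else (if (j : ℕ) = 0 then (1 + τ) / 2
            else if (j : ℕ) = 1 then (1 - τ) / 2 else 0))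
    (a : Fin m → ℝ)
    (ha : a = fun j : Fin m =>
      if (j : ℕ) = 0 then τ
      else if (j : ℕ) = 1 then (1 - τ) / 2 + (1 - τ) / (2 * ((m : ℝ) - 1))
      else (1 - τ) / (2 * ((m : ℝ) - 1))) :
    (IsGmaxNormTime P ((1 + τ) / 2) ∧
      cutoff m τ (gmaxAgg P ((1 + τ) / 2)) = a) ∧
    (∀ f : Fin (n + 1) → ℝ → ℝ, IsPhantomSystem n f →
      ∀ t ∈ Set.Icc (0 : ℝ) 1, ¬ (∀ j, IsMedian (phantomMS f P t j) n (a j))) := by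
  obtain ⟨hτ1, hτ2⟩ := hτ
  have hm' : (3 : ℝ) ≤ m := by exact_mod_cast hm
  have hm1 : (0 : ℝ) < 2 * ((m : ℝ) - 1) := by linarith
  have hpos : 0 < (1 - τ) / (2 * ((m : ℝ) - 1)) := div_pos (by linarith) hm1
  let last : Fin n := ⟨n - 1, by omega⟩
  have hbdd (j : Fin m) : BddAbove (Set.range fun i => P i j) := Set.finite_range _ |>.bddAbove
  have : Nonempty (Fin n) := ⟨last⟩
  have hagg : gmaxAgg P ((1 + τ) / 2) = fun j : Fin m =>
      if (j : ℕ) = 0 then (1 + τ) / 2 else if (j : ℕ) = 1 then (1 - τ) / 2 else 0 := by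
    funext j
    have hlast : P last j ≤ ⨆ i, P i j := le_ciSup (hbdd j) last
    have hPlast : P last j =
        if (j : ℕ) = 0 then (1 + τ) / 2 else if (j : ℕ) = 1 then (1 - τ) / 2 else 0 := by
      simp [hPdef, last]
    rw [hPlast] at hlast
    unfold gmaxAgg
    by_cases h0 : (j : ℕ) = 0
    · simp only [h0, if_true] at hlast ⊢
      exact min_eq_left hlast
    · have hsup : (⨆ i, P i j) = if (j : ℕ) = 1 then (1 - τ) / 2 else 0 := by
        apply le_antisymm
        · refine ciSup_le fun i => ?_
          simp only [hPdef, h0, if_false]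
          split_ifs <;> linarith
        · simpa only [h0, if_false] using hlast
      rw [hsup, if_neg h0]
      apply min_eq_right
      split_ifs <;> linarith
  refine ⟨⟨⟨⟨by linarith, by linarith⟩, ?_⟩, ?_⟩, ?_⟩
  · rw [hagg]
    obtain ⟨k, rfl⟩ : ∃ k, m = k + 2 := ⟨m - 2, by omega⟩
    simp [Fin.sum_univ_succ]
    ring
  · let z : Fin m := ⟨0, by omega⟩
    have hz (j : Fin m) : j = z ↔ (j : ℕ) = 0 := Fin.ext_iff
    rw [cutoff_eq_of_unique (k := z), ha]
    · funext j
      have hshare : ((1 + τ) / 2 - τ) / ((m : ℝ) - 1) = (1 - τ) / (2 * ((m : ℝ) - 1)) := by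
        rw [← div_div]
        ring
      simp only [hagg, hz, z, if_true, hshare]
      split_ifs <;> simp
    · simp only [hagg, z, if_true]
      linarith
    · intro l hl
      rw [hz]
      by_contra h0
      simp only [hagg, h0, if_false] at hl
      split_ifs at hl <;> linarith
  · intro f _ t _ hmed
    have h1 := (hmed ⟨1, by omega⟩).phantom_of_votes_lt fun i => by
      simp only [hPdef, ha, one_ne_zero, if_false, if_true]
      split_ifs <;> linarith
    have h2 := (hmed ⟨2, by omega⟩).phantom_of_votes_lt fun i => by
      simpa [hPdef, ha] using hpos
    obtain ⟨k, hk⟩ := h2.2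
    have hle := h1.1 k
    rw [hk] at hle
    norm_num [ha] at hle
    linarith
end

section
/- (Exact aggregate for slow phantom systems with cutoff threshold.) Let m ≥ 2, n ≥ 1, τ ∈ [1/2, 1), and let (f_0,…,f_n) be a phantom system for n voters. Suppose there exist t₁ ≤ t₂ in [0,1] with f_{n−1}(t₁) ≥ 1 − τ, f_0(t₁) ≤ 1 − (m−1)(1−τ), f_0(t₂) = 1, and f_n(t₂) = 0. Let P = (p_1,…,p_n) be a profile and j ∈ {1,…,m} with p_{i,j} ≥ τ for all i ∈ [n]. Define a ∈ ℝ^m by a_k = max_{i ∈ [n]} p_{i,k} for k ≠ j and a_j = 1 − ∑_{k ≠ j} max_{i ∈ [n]} p_{i,k}. Then ∑_{k=1}^m a_k = 1 and there exists t ∈ [t₁, t₂] such that for every k ∈ {1,…,m}, a_k is the median of the multiset {f_0(t), …, f_n(t), p_{1,k}, …, p_{n,k}}. -/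
open scoped Classical BigOperators

/-- Counting in `phantomMS` splits into counting phantoms and counting votes. -/
theorem card_filter_phantomMS {n m : ℕ} (f : Fin (n + 1) → ℝ → ℝ) (P : Fin n → Fin m → ℝ)
    (t : ℝ) (j : Fin m) (q : ℝ → Prop) :
    ((phantomMS f P t j).filter q).card =
      (Finset.univ.filter fun k => q (f k t)).card +
        (Finset.univ.filter fun i => q (P i j)).card := by
  simp only [phantomMS, Multiset.filter_add, Multiset.card_add, Multiset.filter_map,
    Multiset.card_map]
  rfl

/-- If all phantoms lie below all votes, the top phantom is the median. -/
theorem isMedian_phantomMS_of_eq_phantom {n m : ℕ} (f : Fin (n + 1) → ℝ → ℝ)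
    (P : Fin n → Fin m → ℝ) (t : ℝ) (j : Fin m) (x : ℝ) (hx : f 0 t = x)
    (hf : ∀ k, f k t ≤ x) (hP : ∀ i, x ≤ P i j) : IsMedian (phantomMS f P t j) n x := by
  refine ⟨?_, ?_, ?_⟩
  · exact Multiset.mem_add.2 (Or.inl (Multiset.mem_map.2 ⟨0, by simp, hx⟩))
  · rw [card_filter_phantomMS, Finset.filter_true_of_mem fun k _ => hf k]
    simp
  · rw [card_filter_phantomMS, Finset.filter_true_of_mem (p := fun i => x ≤ P i j) fun i _ => hP i]
    have : 0 < (Finset.univ.filter fun k => x ≤ f k t).card :=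
      Finset.card_pos.2 ⟨0, by simp [hx]⟩
    simp only [Finset.card_univ, Fintype.card_fin]
    omega

/-- If the last phantom is below the largest vote and all others are above it, then the largest
vote is the median. -/
theorem isMedian_phantomMS_of_eq_vote {n m : ℕ} (f : Fin (n + 1) → ℝ → ℝ)
    (P : Fin n → Fin m → ℝ) (t : ℝ) (j : Fin m) (x : ℝ) (i₀ : Fin n) (hx : P i₀ j = x)
    (hP : ∀ i, P i j ≤ x) (hlast : f (Fin.last n) t ≤ x)
    (hf : ∀ k : Fin n, x ≤ f k.castSucc t) : IsMedian (phantomMS f P t j) n x := by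
  refine ⟨?_, ?_, ?_⟩
  · exact Multiset.mem_add.2 (Or.inr (Multiset.mem_map.2 ⟨i₀, by simp, hx⟩))
  · rw [card_filter_phantomMS, Finset.filter_true_of_mem (p := fun i => P i j ≤ x) fun i _ => hP i]
    have : 0 < (Finset.univ.filter fun k => f k t ≤ x).card :=
      Finset.card_pos.2 ⟨Fin.last n, by simp [hlast]⟩
    simp only [Finset.card_univ, Fintype.card_fin]
    omega
  · rw [card_filter_phantomMS]
    have hvote : 0 < (Finset.univ.filter fun i => x ≤ P i j).card :=
      Finset.card_pos.2 ⟨i₀, by simp [hx]⟩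
    have hphantom : n ≤ (Finset.univ.filter fun k => x ≤ f k t).card := by
      have hsub : Finset.univ.map Fin.castSuccEmb ⊆ Finset.univ.filter fun k => x ≤ f k t := by
        intro k hk
        obtain ⟨l, -, rfl⟩ := Finset.mem_map.1 hk
        simpa using hf l
      simpa using Finset.card_le_card hsub
    omega

/-- exact aggregate for slow phantom systems with cutoff threshold.
If the phantom system has times t₁ ≤ t₂ with f_{n-1}(t₁) ≥ 1-τ,
f_0(t₁) ≤ 1-(m-1)(1-τ), f_0(t₂) = 1 and f_n(t₂) = 0, and all voters give at least τ
to alternative j, then the vector a (maxima off j, residual on j) sums to 1 and is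
realized as the vector of medians at some time t ∈ [t₁, t₂]. -/
theorem stmt13 (m n : ℕ) (hm : 2 ≤ m) (hn : 1 ≤ n)
    (τ : ℝ) (hτ : τ ∈ Set.Ico (1 / 2 : ℝ) 1)
    (f : Fin (n + 1) → ℝ → ℝ) (hf : IsPhantomSystem n f)
    (t₁ t₂ : ℝ) (ht12 : t₁ ≤ t₂)
    (ht₁ : t₁ ∈ Set.Icc (0 : ℝ) 1) (ht₂ : t₂ ∈ Set.Icc (0 : ℝ) 1)
    (h1 : 1 - τ ≤ f ⟨n - 1, by omega⟩ t₁)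
    (h2 : f 0 t₁ ≤ 1 - ((m : ℝ) - 1) * (1 - τ))
    (h3 : f 0 t₂ = 1) (h4 : f (Fin.last n) t₂ = 0)
    (P : Fin n → Fin m → ℝ) (hP : ∀ i, P i ∈ simplex m)
    (j : Fin m) (hj : ∀ i, τ ≤ P i j)
    (a : Fin m → ℝ)
    (ha : a = fun k : Fin m =>
      if k = j then 1 - ∑ l ∈ Finset.univ.erase j, (⨆ i, P i l) else ⨆ i, P i k) :
    ∑ k, a k = 1 ∧
    ∃ t ∈ Set.Icc t₁ t₂, ∀ k, IsMedian (phantomMS f P t k) n (a k) := by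
  obtain ⟨hcont, hmono, -, -, -, hanti⟩ := hf
  have : Nonempty (Fin n) := ⟨⟨0, hn⟩⟩
  have hle : ∀ i l, P i l ≤ ⨆ i, P i l := fun i l =>
    le_ciSup (f := fun i => P i l) (Set.finite_range _).bddAbove i
  have hsplit : ∀ i, P i j + ∑ l ∈ Finset.univ.erase j, P i l = 1 := fun i => by
    rw [Finset.add_sum_erase _ _ (Finset.mem_univ j), (hP i).2]
  have hsmall : ∀ i, ∀ l ≠ j, P i l ≤ 1 - τ := fun i l hl => by
    have := Finset.single_le_sum (f := P i) (fun x _ => (hP i).1 x)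
      (Finset.mem_erase.2 ⟨hl, Finset.mem_univ l⟩)
    linarith [hsplit i, hj i]
  have hsup : ∀ l ≠ j, ⨆ i, P i l ≤ 1 - τ := fun l hl => ciSup_le fun i => hsmall i l hl
  have haj : a j = 1 - ∑ l ∈ Finset.univ.erase j, (⨆ i, P i l) := by simp [ha]
  have hak : ∀ k ≠ j, a k = ⨆ i, P i k := fun k hk => by simp [ha, hk]
  have haj_le : ∀ i, a j ≤ P i j := fun i => by
    have := Finset.sum_le_sum fun l (_ : l ∈ Finset.univ.erase j) => hle i l
    linarith [hsplit i]
  have hlow : f 0 t₁ ≤ a j := by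
    have hsum := Finset.sum_le_card_nsmul (Finset.univ.erase j) (fun l => ⨆ i, P i l) (1 - τ)
      fun l hl => hsup l (Finset.ne_of_mem_erase hl)
    rw [Finset.card_erase_of_mem (Finset.mem_univ j), Finset.card_univ, Fintype.card_fin,
      nsmul_eq_mul, Nat.cast_sub (by omega), Nat.cast_one] at hsum
    linarith
  have hhigh : a j ≤ f 0 t₂ := by
    have i : Fin n := ⟨0, hn⟩
    have := Finset.sum_nonneg fun l (_ : l ∈ Finset.univ.erase j) => (hP i).1 l
    linarith [haj_le i, hsplit i]
  constructor
  · rw [← Finset.add_sum_erase _ _ (Finset.mem_univ j), haj,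
      Finset.sum_congr rfl fun k hk => hak k (Finset.ne_of_mem_erase hk)]
    ring
  obtain ⟨t, ht, hft⟩ := intermediate_value_Icc ht12
    ((hcont 0).mono (Set.Icc_subset_Icc ht₁.1 ht₂.2)) ⟨hlow, hhigh⟩
  have ht01 : t ∈ Set.Icc (0 : ℝ) 1 := ⟨ht₁.1.trans ht.1, ht.2.trans ht₂.2⟩
  refine ⟨t, ht, fun k => ?_⟩
  obtain rfl | hk := eq_or_ne k j
  · exact isMedian_phantomMS_of_eq_phantom f P t k _ hft
      (fun l => (hanti t ht01 0 l (Fin.zero_le l)).trans_eq hft) haj_le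
  · rw [hak k hk]
    obtain ⟨i₀, hi₀⟩ := exists_eq_ciSup_of_finite (f := fun i => P i k)
    refine isMedian_phantomMS_of_eq_vote f P t k _ i₀ hi₀ (fun i => hle i k) ?_ fun l => ?_
    · have := hmono (Fin.last n) ht01 ht₂ ht.2
      linarith [(hP i₀).1 k, hle i₀ k]
    · have hlast := hanti t ht01 l.castSucc ⟨n - 1, by omega⟩
        (Fin.le_def.2 (by have := l.isLt; simp only [Fin.val_castSucc]; omega))
      have := hmono ⟨n - 1, by omega⟩ ht₁ ht01 ht.1
      linarith [hsup k hk]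
end

section
/- (Basic properties of GreedyMin.) Let m ≥ 2, n ≥ 1, and let P = (p_1,…,p_n) be a profile in (Δ^{m−1})^n. Then: (i) there exists a GreedyMin normalization time t ∈ [1/2, (1+m)/(2m)]; (ii) for every GreedyMin normalization time t with associated GreedyMin aggregate a: a_j ≤ max(1/m, min_{i ∈ [n]} p_{i,j}) for all j ∈ {1,…,m}; a_j ≥ min_{i ∈ [n]} p_{i,j} for all j ∈ {1,…,m}; and for every i ∈ [n] and every k with p_{i,k} = min_{j ∈ [m]} p_{i,j}, it holds that a_k ≥ p_{i,k}. -/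
open scoped Classical BigOperators

/-- The median of a multiset of odd cardinality: the middle element of its sorted list. -/
noncomputable def msMedian (M : Multiset ℝ) : ℝ :=
  (M.sort (· ≤ ·)).getD (M.card / 2) 0

/-- The GreedyMin phantom system: f_0(t) = min(2t, 1), f_1 = … = f_n = max(0, 2t-1). -/
noncomputable def gminPhantom (n : ℕ) : Fin (n + 1) → ℝ → ℝ :=
  fun k t => if k = 0 then min (2 * t) 1 else max 0 (2 * t - 1)

/-- The GreedyMin medians med_j(t). -/
noncomputable def gminMed {n m : ℕ} (P : Fin n → Fin m → ℝ) (t : ℝ) : Fin m → ℝ :=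
  fun j => msMedian (phantomMS (gminPhantom n) P t j)

/-- t is a GreedyMin normalization time if t ∈ [0,1] and the medians sum to 1;
the associated GreedyMin aggregate is gminMed P t. -/
noncomputable def IsGminNormTime {n m : ℕ} (P : Fin n → Fin m → ℝ) (t : ℝ) : Prop :=
  t ∈ Set.Icc (0 : ℝ) 1 ∧ ∑ j, gminMed P t j = 1

theorem msMedian_le {M : Multiset ℝ} {n : ℕ} {x : ℝ} (hM : M.card = 2 * n + 1)
    (h : n + 1 ≤ M.countP (· ≤ x)) : msMedian M ≤ x := by
  have hlen : n < (M.sort (· ≤ ·)).length := by rw [Multiset.length_sort]; omega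
  have hn : M.card / 2 = n := by omega
  rw [msMedian, hn, List.getD_eq_getElem _ _ hlen]
  by_contra! hx
  rw [← Multiset.sort_eq M (· ≤ ·), Multiset.coe_countP,
    ← List.take_append_drop n (M.sort (· ≤ ·)), List.countP_append] at h
  have h₁ : ((M.sort (· ≤ ·)).take n).countP (· ≤ x) ≤ n :=
    List.countP_le_length.trans (List.length_take_le _ _)
  have h₂ : ((M.sort (· ≤ ·)).drop n).countP (· ≤ x) = 0 := by
    rw [List.countP_eq_zero]
    intro a ha
    obtain ⟨i, hi, rfl⟩ := List.getElem_of_mem ha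
    rw [List.getElem_drop]
    have := (Multiset.pairwise_sort M (· ≤ ·)).sortedLE.getElem_le_getElem_of_le
      (i := n) (j := n + i) (hi := hlen) (hj := by simp at hi ⊢; omega) (by omega)
    simpa using hx.trans_le this
  omega

theorem le_msMedian {M : Multiset ℝ} {n : ℕ} {x : ℝ} (hM : M.card = 2 * n + 1)
    (h : n + 1 ≤ M.countP (x ≤ ·)) : x ≤ msMedian M := by
  have hlen : n < (M.sort (· ≤ ·)).length := by rw [Multiset.length_sort]; omega
  have hlen' : (M.sort (· ≤ ·)).length = 2 * n + 1 := by rw [Multiset.length_sort, hM]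
  have hn : M.card / 2 = n := by omega
  rw [msMedian, hn, List.getD_eq_getElem _ _ hlen]
  by_contra! hx
  rw [← Multiset.sort_eq M (· ≤ ·), Multiset.coe_countP,
    ← List.take_append_drop (n + 1) (M.sort (· ≤ ·)), List.countP_append] at h
  have h₁ : ((M.sort (· ≤ ·)).drop (n + 1)).countP (x ≤ ·) ≤ n :=
    List.countP_le_length.trans (by rw [List.length_drop]; omega)
  have h₂ : ((M.sort (· ≤ ·)).take (n + 1)).countP (x ≤ ·) = 0 := by
    rw [List.countP_eq_zero]
    intro a ha
    obtain ⟨i, hi, rfl⟩ := List.getElem_of_mem ha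
    rw [List.getElem_take]
    have hi' : i ≤ n := by rw [List.length_take] at hi; omega
    have := (Multiset.pairwise_sort M (· ≤ ·)).sortedLE.getElem_le_getElem_of_le
      (i := i) (j := n) (hi := by omega) (hj := hlen) hi'
    simpa using this.trans_lt hx
  omega

theorem msMedian_cons_replicate_add {n : ℕ} {L U μ : ℝ} {s : Multiset ℝ} (hs : s.card = n)
    (hLU : L ≤ U) (hμ : μ ∈ s) (hmin : ∀ y ∈ s, μ ≤ y) :
    msMedian (U ::ₘ (Multiset.replicate n L + s)) = max L (min U μ) := by
  have hcard : (U ::ₘ (Multiset.replicate n L + s)).card = 2 * n + 1 := by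
    simp [hs]; omega
  have hrep (p : ℝ → Prop) [DecidablePred p] (hp : p L) :
      (Multiset.replicate n L).countP p = n := by
    conv_rhs => rw [← Multiset.card_replicate n L]
    rw [Multiset.countP_eq_card]
    intro a ha
    rwa [Multiset.eq_of_mem_replicate ha]
  apply le_antisymm
  · apply msMedian_le hcard
    rw [Multiset.countP_cons, Multiset.countP_add, hrep _ (le_max_left _ _)]
    rcases le_total U μ with h | h
    · rw [if_pos (by simp [h])]; omega
    · have : 0 < s.countP (· ≤ max L (min U μ)) :=
        Multiset.countP_pos.2 ⟨μ, hμ, by simp [h]⟩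
      omega
  · apply le_msMedian hcard
    rw [Multiset.countP_cons, Multiset.countP_add, if_pos (by simp [hLU])]
    rcases le_total L (min U μ) with h | h
    · have : s.countP (max L (min U μ) ≤ ·) = s.card := by
        rw [Multiset.countP_eq_card]
        intro y hy
        rw [max_eq_right h]
        exact (min_le_right _ _).trans (hmin y hy)
      omega
    · rw [hrep _ (by simpa using h)]; omega

theorem gminMed_eq {n m : ℕ} (hn : 1 ≤ n) (P : Fin n → Fin m → ℝ) {t : ℝ}
    (ht : t ∈ Set.Icc (0 : ℝ) 1) (j : Fin m) :
    gminMed P t j = max (max 0 (2 * t - 1)) (min (min (2 * t) 1) (⨅ i, P i j)) := by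
  have : Nonempty (Fin n) := ⟨⟨0, hn⟩⟩
  have hsplit : (Finset.univ.val.map fun k => gminPhantom n k t) =
      min (2 * t) 1 ::ₘ Multiset.replicate n (max 0 (2 * t - 1)) := by
    rw [Fin.univ_succ]
    simp [gminPhantom, Function.comp_def, ← Multiset.coe_replicate]
  obtain ⟨i₀, hi₀⟩ := exists_eq_ciInf_of_finite (f := fun i => P i j)
  rw [gminMed, phantomMS, hsplit, Multiset.cons_add]
  apply msMedian_cons_replicate_add
  · simp
  · obtain ⟨h0, h1⟩ := ht
    simp only [max_le_iff, le_min_iff]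
    refine ⟨⟨?_, ?_⟩, ?_, ?_⟩ <;> linarith
  · exact Multiset.mem_map.2 ⟨i₀, Finset.mem_univ_val _, hi₀⟩
  · intro y hy
    obtain ⟨i, -, rfl⟩ := Multiset.mem_map.1 hy
    exact ciInf_le (Set.finite_range _).bddBelow i

/-- basic properties of GreedyMin: a normalization time exists in
[1/2, (1+m)/(2m)], and any GreedyMin aggregate a satisfies
a_j ≤ max(1/m, min_i p_{i,j}), a_j ≥ min_i p_{i,j}, and a_k ≥ p_{i,k} whenever
k minimizes p_{i,·}. -/
theorem stmt14 (m n : ℕ) (hm : 2 ≤ m) (hn : 1 ≤ n)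
    (P : Fin n → Fin m → ℝ) (hP : ∀ i, P i ∈ simplex m) :
    (∃ t ∈ Set.Icc (1 / 2 : ℝ) ((1 + (m : ℝ)) / (2 * m)), IsGminNormTime P t) ∧
    (∀ t : ℝ, IsGminNormTime P t →
      (∀ j, gminMed P t j ≤ max ((1 : ℝ) / m) (⨅ i, P i j)) ∧
      (∀ j, (⨅ i, P i j) ≤ gminMed P t j) ∧
      (∀ i : Fin n, ∀ k : Fin m, (∀ j, P i k ≤ P i j) → P i k ≤ gminMed P t k)) := by
  have : Nonempty (Fin n) := ⟨⟨0, hn⟩⟩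
  have hm0 : (0 : ℝ) < m := by positivity
  have hm1 : (1 : ℝ) ≤ m := by exact_mod_cast (by omega : 1 ≤ m)
  have hle (i j) : (⨅ i, P i j) ≤ P i j := ciInf_le (Set.finite_range _).bddBelow i
  have hnonneg (j) : 0 ≤ ⨅ i, P i j := le_ciInf fun i => (hP i).1 j
  have hsum : ∑ j, (⨅ i, P i j) ≤ 1 := by
    rw [← (hP ⟨0, hn⟩).2]
    exact Finset.sum_le_sum fun j _ => hle _ j
  have hle1 (j) : (⨅ i, P i j) ≤ 1 :=
    (Finset.single_le_sum (f := fun j => ⨅ i, P i j) (fun j _ => hnonneg j)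
      (Finset.mem_univ j)).trans hsum
  refine ⟨?_, fun t ht => ?_⟩
  · set b : ℝ := (1 + (m : ℝ)) / (2 * m) with hb
    have hb2 : 2 * b - 1 = 1 / m := by rw [hb]; field_simp; ring
    have hb_ge : 1 / 2 ≤ b := by
      have : 0 < 1 / (m : ℝ) := by positivity
      linarith
    have hb_le : b ≤ 1 := by
      have : 1 / (m : ℝ) ≤ 1 := (div_le_one hm0).2 hm1
      linarith
    let g : ℝ → ℝ := fun t =>
      ∑ j, max (max 0 (2 * t - 1)) (min (min (2 * t) 1) (⨅ i, P i j))
    have hg : Continuous g := by fun_prop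
    have hmem : (1 : ℝ) ∈ Set.Icc (g (1 / 2)) (g b) := by
      constructor
      · refine le_trans (Finset.sum_le_sum fun j _ => ?_) hsum
        simp [hnonneg j]
      · calc (1 : ℝ) = ∑ _j : Fin m, 1 / (m : ℝ) := by simp [hm0.ne']
          _ ≤ g b := Finset.sum_le_sum fun j _ => by
            rw [hb2]
            exact (le_max_right _ _).trans (le_max_left _ _)
    obtain ⟨t, ht, hgt⟩ := intermediate_value_Icc hb_ge hg.continuousOn hmem
    have ht01 : t ∈ Set.Icc (0 : ℝ) 1 := ⟨by linarith [ht.1], ht.2.trans hb_le⟩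
    exact ⟨t, ht, ht01, by simpa only [gminMed_eq hn P ht01] using hgt⟩
  · obtain ⟨ht01, hs⟩ := ht
    have hmed := gminMed_eq hn P ht01
    set L : ℝ := max 0 (2 * t - 1) with hL
    have hLmed (j) : L ≤ gminMed P t j := by rw [hmed]; exact le_max_left _ _
    have hmedle (j) : gminMed P t j ≤ max L (⨅ i, P i j) := by
      rw [hmed]; exact max_le_max_left _ (min_le_right _ _)
    refine ⟨fun j => ?_, fun j => ?_, fun i k hk => ?_⟩
    · refine (hmedle j).trans (max_le_max_right _ ?_)
      rw [le_div_iff₀ hm0, ← hs]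
      calc L * m = ∑ _j : Fin m, L := by simp [mul_comm]
        _ ≤ _ := Finset.sum_le_sum fun j _ => hLmed j
    · rcases le_total (1 / 2) t with h | h
      · rw [hmed]
        refine le_max_of_le_right (le_min (le_min ?_ (hle1 j)) le_rfl)
        linarith [hle1 j]
      · have hL0 : L = 0 := max_eq_left (by linarith)
        by_contra! hlt
        have : ∑ j, gminMed P t j < ∑ j, ⨅ i, P i j :=
          Finset.sum_lt_sum
            (fun j _ => (hmedle j).trans (by rw [hL0, max_eq_right (hnonneg j)]))
            ⟨j, Finset.mem_univ j, hlt⟩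
        linarith
    · by_contra! hlt
      have : ∑ j, gminMed P t j < ∑ j, P i j :=
        Finset.sum_lt_sum
          (fun j _ => (hmedle j).trans
            (max_le (((hLmed k).trans hlt.le).trans (hk j)) (hle i j)))
          ⟨k, Finset.mem_univ k, hlt⟩
      linarith [(hP i).2]
end

section
/- Let n = 2 and m = 3. Let v, w, w' ∈ Δ² and δ > 0 with w' = (w_1 + δ, w_2 − δ/2, w_3 − δ/2) ∈ Δ², and suppose w_1 ≥ 0.8 and w_1 ≥ v_1. Let a be a GreedyMin aggregate (at any GreedyMin normalization time) of the profile (v, w), and let a' be a GreedyMin aggregate of the profile (v, w'). Then ‖v − a‖₁ ≤ ‖v − a'‖₁. -/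
open scoped Classical BigOperators

theorem msMedian_coe_of_pairwise {l : List ℝ} (h : l.Pairwise (· ≤ ·)) :
    msMedian (l : Multiset ℝ) = l.getD (l.length / 2) 0 := by
  rw [msMedian, Multiset.coe_card, Multiset.coe_sort, List.mergeSort_of_pairwise]
  simpa using h

theorem msMedian_phantoms {a b : ℝ} (hab : b ≤ a) (p q : ℝ) :
    msMedian ({a} + {b} + {b} + {p} + {q}) = max b (min a (min p q)) := by
  wlog hpq : p ≤ q generalizing p q
  · rw [add_right_comm _ ({p} : Multiset ℝ) {q}, min_comm p q]
    exact this q p (le_of_not_ge hpq)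
  have key : ∀ l : List ℝ, l.Pairwise (· ≤ ·) →
      ({a} + {b} + {b} + {p} + {q} : Multiset ℝ) = l →
      msMedian ({a} + {b} + {b} + {p} + {q}) = l.getD (l.length / 2) 0 := fun l hl h => by
    rw [h, msMedian_coe_of_pairwise hl]
  have sum_eq : ∀ x₁ x₂ x₃ x₄ x₅ : ℝ, (([x₁, x₂, x₃, x₄, x₅] : List ℝ) : Multiset ℝ) =
      {x₁} + {x₂} + {x₃} + {x₄} + {x₅} := fun _ _ _ _ _ => rfl
  rw [min_eq_left hpq]
  rcases le_total b p with hbp | hpb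
  · have hbq := hbp.trans hpq
    rcases le_total a p with hap | hpa
    · rw [key [b, b, a, p, q] (by simp; grind) (by rw [sum_eq]; abel)]
      simp [hap, hab]
    rcases le_total a q with haq | hqa
    · rw [key [b, b, p, a, q] (by simp; grind) (by rw [sum_eq]; abel)]
      simp [hpa, hbp]
    · rw [key [b, b, p, q, a] (by simp; grind) (by rw [sum_eq]; abel)]
      simp [hpa, hbp]
  · rw [max_eq_left (min_le_of_right_le hpb)]
    rcases le_total q b with hqb | hbq
    · rw [key [p, q, b, b, a] (by simp; grind) (by rw [sum_eq]; abel)]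
      simp
    rcases le_total a q with haq | hqa
    · rw [key [p, b, b, a, q] (by simp; grind) (by rw [sum_eq]; abel)]
      simp
    · rw [key [p, b, b, q, a] (by simp; grind) (by rw [sum_eq]; abel)]
      simp

theorem gminMed_two {m : ℕ} (v w : Fin m → ℝ) {t : ℝ} (ht : t ∈ Set.Icc (0 : ℝ) 1) (j : Fin m) :
    gminMed ![v, w] t j =
      max (max 0 (2 * t - 1)) (min (min (2 * t) 1) (min (v j) (w j))) := by
  obtain ⟨h0, h1⟩ := ht
  rw [← msMedian_phantoms (max_le (le_min (by linarith) zero_le_one)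
    (le_min (by linarith) (by linarith)))]
  rfl

/-- A two-voter GreedyMin aggregate is the coordinatewise minimum of the votes, raised to a
common level `b`. -/
theorem exists_level_gminMed {m : ℕ} {v w : Fin m → ℝ} (hv : v ∈ simplex m) (hw : w ∈ simplex m)
    {t : ℝ} (ht : IsGminNormTime ![v, w] t) :
    ∃ b : ℝ, ∀ j, gminMed ![v, w] t j = max b (min (v j) (w j)) := by
  obtain ⟨hmem, hsum⟩ := ht
  rcases le_total (1 / 2) t with h | h
  · refine ⟨max 0 (2 * t - 1), fun j => ?_⟩
    have hle : v j ≤ 1 := hv.2 ▸ Finset.single_le_sum (fun i _ => hv.1 i) (Finset.mem_univ j)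
    rw [gminMed_two v w hmem, min_eq_right (a := 2 * t) (by linarith),
      min_eq_right (min_le_of_left_le hle)]
  · refine ⟨0, fun j => ?_⟩
    have hle : ∀ i ∈ Finset.univ, gminMed ![v, w] t i ≤ min (v i) (w i) := fun i _ => by
      rw [gminMed_two v w hmem, max_eq_left (by linarith : 2 * t - 1 ≤ 0)]
      exact max_le (le_min (hv.1 i) (hw.1 i)) (min_le_right _ _)
    have hsum' : ∑ i, min (v i) (w i) ≤ 1 :=
      hv.2 ▸ Finset.sum_le_sum fun i _ => min_le_left _ _
    rw [max_eq_right (le_min (hv.1 j) (hw.1 j))]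
    exact (Finset.sum_eq_sum_iff_of_le hle).1
      (le_antisymm (Finset.sum_le_sum hle) (hsum.symm ▸ hsum')) j (Finset.mem_univ j)

theorem dist1_eq_two_mul_sum_posPart {m : ℕ} {v a : Fin m → ℝ} (h : ∑ j, v j = ∑ j, a j) :
    dist1 v a = 2 * ∑ j, max 0 (a j - v j) := by
  have h' : ∑ j, (v j - a j) = 0 := by rw [Finset.sum_sub_distrib, h, sub_self]
  rw [dist1, Finset.mul_sum, ← sub_eq_zero, ← Finset.sum_sub_distrib]
  refine Eq.trans ?_ h'
  refine Finset.sum_congr rfl fun j _ => ?_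
  rcases le_total (a j) (v j) with hj | hj
  · rw [abs_of_nonneg (sub_nonneg.2 hj), max_eq_left (sub_nonpos.2 hj)]
    ring
  · rw [abs_of_nonpos (sub_nonpos.2 hj), max_eq_right (sub_nonneg.2 hj)]
    ring

theorem max_zero_max_min_sub (b x y : ℝ) : max 0 (max b (min x y) - x) = max 0 (b - x) := by
  grind

/-- If the coordinatewise minimum of the two votes decreases, the distance of the GreedyMin
aggregate to `v` does not decrease. -/
theorem dist1_gminMed_le_of_min_le {m : ℕ} {v w w' : Fin m → ℝ} (hv : v ∈ simplex m)
    (hw : w ∈ simplex m) (hw' : w' ∈ simplex m) (hle : ∀ j, min (v j) (w' j) ≤ min (v j) (w j))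
    {t t' : ℝ} (ht : IsGminNormTime ![v, w] t) (ht' : IsGminNormTime ![v, w'] t') :
    dist1 v (gminMed ![v, w] t) ≤ dist1 v (gminMed ![v, w'] t') := by
  obtain ⟨b, hb⟩ := exists_level_gminMed hv hw ht
  obtain ⟨b', hb'⟩ := exists_level_gminMed hv hw' ht'
  rcases le_total b b' with h | h
  · rw [dist1_eq_two_mul_sum_posPart (hv.2.trans ht.2.symm),
      dist1_eq_two_mul_sum_posPart (hv.2.trans ht'.2.symm)]
    simp only [hb, hb', max_zero_max_min_sub]
    gcongr
  · have hmono : ∀ j ∈ Finset.univ, gminMed ![v, w'] t' j ≤ gminMed ![v, w] t j := fun j _ => by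
      rw [hb, hb']
      exact max_le_max h (hle j)
    have heq := (Finset.sum_eq_sum_iff_of_le hmono).1 (ht'.2.trans ht.2.symm)
    rw [funext fun j => heq j (Finset.mem_univ j)]

/-- moving the other voter's (already extreme, ≥ 0.8 on alternative 1)
vote further away from voter v on alternative 1 cannot help voter v under GreedyMin. -/
theorem stmt15 (v w w' : Fin 3 → ℝ)
    (hv : v ∈ simplex 3) (hw : w ∈ simplex 3) (hw' : w' ∈ simplex 3)
    (δ : ℝ) (hδ : 0 < δ)
    (hdef : w' = ![w 0 + δ, w 1 - δ / 2, w 2 - δ / 2])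
    (h08 : (8 / 10 : ℝ) ≤ w 0) (hvw : v 0 ≤ w 0)
    (t t' : ℝ)
    (ht : IsGminNormTime ![v, w] t)
    (ht' : IsGminNormTime ![v, w'] t') :
    dist1 v (gminMed ![v, w] t) ≤ dist1 v (gminMed ![v, w'] t') := by
  refine dist1_gminMed_le_of_min_le hv hw hw' (fun j => ?_) ht ht'
  subst hdef
  fin_cases j
  · exact (min_le_left _ _).trans (le_min le_rfl hvw)
  · exact min_le_min le_rfl (sub_le_self _ (by positivity))
  · exact min_le_min le_rfl (sub_le_self _ (by positivity))
end

section
/- (CutoffMaxUtilitarianWelfare violates truthfulness for every constant threshold.) Let n = 2, m = 3, and τ ∈ [1/2, 1). Define the MaxUtilitarianWelfare phantom system f_k(t) = min(1, max(0, 3t − k)) for k = 0, 1, 2. Let P = (p_1, p_2) with p_1 = ((1+3τ)/4, (3−3τ)/4, 0) and p_2 = ((1+τ)/2, (1−τ)/4, (1−τ)/4), and let P* = (p_1*, p_2) with p_1* = (τ, 1−τ, 0). Let b = ((1+3τ)/4, (1−τ)/2, (1−τ)/4) and b* = (τ, (3−3τ)/4, (1−τ)/4). Then: (i) there exists t ∈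 [0,1] such that for every j ∈ {1,2,3}, b_j is the median of the multiset {f_0(t), f_1(t), f_2(t), p_{1,j}, p_{2,j}} (and ∑_j b_j = 1); (ii) there exists t* ∈ [0,1] such that for every j ∈ {1,2,3}, b*_j is the median of the multiset {f_0(t*), f_1(t*), f_2(t*), p*_{1,j}, p*_{2,j}} (and ∑_j b*_j = 1); (iii) ‖p_1 − c_τ(b*)‖₁ < ‖p_1 − c_τ(b)‖₁, i.e., voter 1 strictly benefits from misreporting p_1* under the mechanism obtained by composing the MaxUtilitarianWelfare moving-phantom mechanism with the cutoff c_τ. -/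
open scoped Classical BigOperators

theorem phantomMS_eq (g : Fin 3 → ℝ → ℝ) (q r : Fin 3 → ℝ) (t : ℝ) (j : Fin 3) :
    phantomMS g ![q, r] t j = {g 0 t, g 1 t, g 2 t, q j, r j} := by
  simp [phantomMS, Fin.univ_val_map, List.ofFn_succ]
  rfl

theorem isMedian_of_le {M : Multiset ℝ} {a b x c d : ℝ} (hM : M = {a, b, x, c, d})
    (ha : a ≤ x) (hb : b ≤ x) (hc : x ≤ c) (hd : x ≤ d) : IsMedian M 2 x := by
  subst hM
  refine ⟨by simp, ?_, ?_⟩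
  · calc 2 + 1 = (Multiset.filter (fun y => y ≤ x) {a, b, x}).card := by
          simp [ha, hb, Multiset.filter_singleton]
      _ ≤ _ := Multiset.card_le_card (Multiset.filter_le_filter _ ?_)
    exact Multiset.cons_le_cons _ (Multiset.cons_le_cons _
      (Multiset.cons_le_cons _ (Multiset.zero_le _)))
  · calc 2 + 1 = (Multiset.filter (fun y => x ≤ y) {x, c, d}).card := by
          simp [hc, hd, Multiset.filter_singleton]
      _ ≤ _ := Multiset.card_le_card (Multiset.filter_le_filter _ ?_)
    exact (Multiset.le_cons_self _ _).trans (Multiset.le_cons_self _ _)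

/-- The phantoms of MaxUtilitarianWelfare for two voters at time `(1 + v) / 3`
are `1`, `v` and `0`. -/
theorem phantomMS_maxUtilitarian {v : ℝ} (h0 : 0 ≤ v) (h1 : v ≤ 1) (q r : Fin 3 → ℝ)
    (j : Fin 3) :
    phantomMS (fun (k : Fin 3) (t : ℝ) => min 1 (max 0 (3 * t - ((k : ℕ) : ℝ)))) ![q, r]
      ((1 + v) / 3) j = {1, v, 0, q j, r j} := by
  have e0 : min 1 (max 0 (3 * ((1 + v) / 3) - (((0 : Fin 3) : ℕ) : ℝ))) = 1 := by
    rw [max_eq_right, min_eq_left] <;> simp <;> linarith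
  have e1 : min 1 (max 0 (3 * ((1 + v) / 3) - (((1 : Fin 3) : ℕ) : ℝ))) = v := by
    have : 3 * ((1 + v) / 3) - (((1 : Fin 3) : ℕ) : ℝ) = v := by simp; ring
    rw [this, max_eq_right h0, min_eq_right h1]
  have e2 : min 1 (max 0 (3 * ((1 + v) / 3) - (((2 : Fin 3) : ℕ) : ℝ))) = 0 := by
    rw [max_eq_left, min_eq_right] <;> simp
    linarith
  rw [phantomMS_eq, e0, e1, e2]

theorem cutoff_eq_self {m : ℕ} {τ : ℝ} {a : Fin m → ℝ} (h : ∀ k, a k ≤ τ) :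
    cutoff m τ a = a :=
  dif_neg (by simpa using h)

theorem cutoff_of_unique {m : ℕ} {τ : ℝ} {a : Fin m → ℝ} {k : Fin m} (hk : τ < a k)
    (hu : ∀ j, j ≠ k → a j ≤ τ) :
    cutoff m τ a = fun j => if j = k then τ else a j + (a k - τ) / ((m : ℝ) - 1) := by
  have h : ∃ k, τ < a k := ⟨k, hk⟩
  have hc : Classical.choose h = k := by
    by_contra hne
    exact absurd (Classical.choose_spec h) (not_lt.mpr (hu _ hne))
  rw [cutoff, dif_pos h, hc]

/-- CutoffMaxUtilitarianWelfare violates truthfulness for every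
constant threshold τ ∈ [1/2, 1): on the given two-voter three-alternative profile,
b and b* are the MaxUtilitarianWelfare aggregates before and after voter 1's
misreport, and the misreport strictly helps voter 1 after the cutoff. -/
theorem stmt16 (τ : ℝ) (hτ : τ ∈ Set.Ico (1 / 2 : ℝ) 1)
    (f : Fin 3 → ℝ → ℝ)
    (hf : f = fun (k : Fin 3) (t : ℝ) => min 1 (max 0 (3 * t - ((k : ℕ) : ℝ))))
    (p₁ p₂ p₁s : Fin 3 → ℝ)
    (hp₁ : p₁ = ![(1 + 3 * τ) / 4, (3 - 3 * τ) / 4, 0])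
    (hp₂ : p₂ = ![(1 + τ) / 2, (1 - τ) / 4, (1 - τ) / 4])
    (hp₁s : p₁s = ![τ, 1 - τ, 0])
    (b bs : Fin 3 → ℝ)
    (hb : b = ![(1 + 3 * τ) / 4, (1 - τ) / 2, (1 - τ) / 4])
    (hbs : bs = ![τ, (3 - 3 * τ) / 4, (1 - τ) / 4]) :
    (∃ t ∈ Set.Icc (0 : ℝ) 1,
      (∀ j, IsMedian (phantomMS f ![p₁, p₂] t j) 2 (b j)) ∧ ∑ j, b j = 1) ∧
    (∃ t ∈ Set.Icc (0 : ℝ) 1,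
      (∀ j, IsMedian (phantomMS f ![p₁s, p₂] t j) 2 (bs j)) ∧ ∑ j, bs j = 1) ∧
    dist1 p₁ (cutoff 3 τ bs) < dist1 p₁ (cutoff 3 τ b) := by
  obtain ⟨h1, h2⟩ := hτ
  subst hf hp₁ hp₂ hp₁s hb hbs
  refine ⟨⟨(1 + (1 - τ) / 2) / 3, ⟨by linarith, by linarith⟩, ?_, ?_⟩,
    ⟨(1 + (3 - 3 * τ) / 4) / 3, ⟨by linarith, by linarith⟩, ?_, ?_⟩, ?_⟩
  · intro j
    have key := phantomMS_maxUtilitarian (v := (1 - τ) / 2) (by linarith) (by linarith)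
      ![(1 + 3 * τ) / 4, (3 - 3 * τ) / 4, 0] ![(1 + τ) / 2, (1 - τ) / 4, (1 - τ) / 4] j
    obtain rfl | rfl | rfl : j = 0 ∨ j = 1 ∨ j = 2 := by fin_cases j <;> simp
    · refine isMedian_of_le (a := 0) (b := (1 - τ) / 2) (c := 1) (d := (1 + τ) / 2)
        (key.trans ?_) ?_ ?_ ?_ ?_ <;> simp only [Matrix.cons_val]
      · ext z
        simp [Multiset.insert_eq_cons, Multiset.count_cons, Multiset.count_singleton]
        ring
      all_goals linarith
    · refine isMedian_of_le (a := 0) (b := (1 - τ) / 4) (c := 1) (d := (3 - 3 * τ) / 4)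
        (key.trans ?_) ?_ ?_ ?_ ?_ <;> simp only [Matrix.cons_val]
      · ext z
        simp [Multiset.insert_eq_cons, Multiset.count_cons, Multiset.count_singleton]
        ring
      all_goals linarith
    · refine isMedian_of_le (a := 0) (b := 0) (c := 1) (d := (1 - τ) / 2)
        (key.trans ?_) ?_ ?_ ?_ ?_ <;> simp only [Matrix.cons_val]
      · ext z
        simp [Multiset.insert_eq_cons, Multiset.count_cons, Multiset.count_singleton]
        ring
      all_goals linarith
  · simp [Fin.sum_univ_three]; ring
  · intro j
    have key := phantomMS_maxUtilitarian (v := (3 - 3 * τ) / 4) (by linarith) (by linarith)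
      ![τ, 1 - τ, 0] ![(1 + τ) / 2, (1 - τ) / 4, (1 - τ) / 4] j
    obtain rfl | rfl | rfl : j = 0 ∨ j = 1 ∨ j = 2 := by fin_cases j <;> simp
    · refine isMedian_of_le (a := 0) (b := (3 - 3 * τ) / 4) (c := 1) (d := (1 + τ) / 2)
        (key.trans ?_) ?_ ?_ ?_ ?_ <;> simp only [Matrix.cons_val]
      · ext z
        simp [Multiset.insert_eq_cons, Multiset.count_cons, Multiset.count_singleton]
        ring
      all_goals linarith
    · refine isMedian_of_le (a := 0) (b := (1 - τ) / 4) (c := 1) (d := 1 - τ)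
        (key.trans ?_) ?_ ?_ ?_ ?_ <;> simp only [Matrix.cons_val]
      · ext z
        simp [Multiset.insert_eq_cons, Multiset.count_cons, Multiset.count_singleton]
        ring
      all_goals linarith
    · refine isMedian_of_le (a := 0) (b := 0) (c := 1) (d := (3 - 3 * τ) / 4)
        (key.trans ?_) ?_ ?_ ?_ ?_ <;> simp only [Matrix.cons_val]
      · ext z
        simp [Multiset.insert_eq_cons, Multiset.count_cons, Multiset.count_singleton]
        ring
      all_goals linarith
  · simp [Fin.sum_univ_three]; ring
  · rw [cutoff_eq_self, cutoff_of_unique (k := 0)]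
    · have a1 : |(1 + 3 * τ) / 4 - τ| = (1 - τ) / 4 := by
        rw [abs_of_nonneg] <;> linarith
      have a2 : |(0 : ℝ) - (1 - τ) / 4| = (1 - τ) / 4 := by
        rw [abs_of_nonpos] <;> linarith
      have a3 : |(3 - 3 * τ) / 4 - ((1 - τ) / 2 + ((1 + 3 * τ) / 4 - τ) / (3 - 1))| =
          (1 - τ) / 8 := by
        rw [abs_of_nonneg] <;> linarith
      have a4 : |(0 : ℝ) - ((1 - τ) / 4 + ((1 + 3 * τ) / 4 - τ) / (3 - 1))| =
          3 * (1 - τ) / 8 := by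
        rw [abs_of_nonpos] <;> linarith
      simp only [dist1, Fin.sum_univ_three, Nat.cast_ofNat, Matrix.cons_val, if_true, one_ne_zero,
        Fin.reduceEq, if_false, a1, a2, a3, a4, sub_self, abs_zero]
      linarith
    · simp only [Matrix.cons_val]
      linarith
    · intro j hj
      fin_cases j <;> simp at hj ⊢ <;> linarith
    · intro j
      fin_cases j <;> simp <;> linarith
end
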